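/- Let q be a prime power of characteristic p, d = k+m ≤ q−1, k ≥ 1, m ≥ 0, and let f ∈ F_q[x] with f(0) = 1 and deg f ≤ d. For k+1 ≤ r ≤ d, let N_2 be the number of pairs ((x_1,…,x_r), h) where x_1,…,x_r ∈ F_q are pairwise distinct, h ∈ F_q[x] has degree at most d−r and h(0) = 1, and (1−x_1 x)(1−x_2 x)⋯(1−x_r x)·h(x) ≡ f(x) (mod x^{m+1}). Then |N_2 − (q)_r · q^{k−r}| ≤ (q/p + m√q + r − 1)_r · C(m−1, d−r) · q^{(d−r)/2}, where (a)_r = a(a−1)⋯(a−r+1) is the falling factorial. -/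

import Mathlib

open Polynomial

/-- Falling factorial `(a)_r = a(a-1)⋯(a-r+1)` with real argument. -/
noncomputable def fallFac (a : ℝ) (r : ℕ) : ℝ := ∏ i ∈ Finset.range r, (a - i)

namespace St

def gsum (q i : ℕ) : ℕ := ∑ j ∈ Finset.range (i+1), q^j
def wt (q m i : ℕ) : ℕ := q^(m-1-i) * gsum q i
def W (q m : ℕ) (a : ℕ → ℕ) : ℕ := ∑ i ∈ Finset.range m, a i * wt q m i
def Red (q m : ℕ) (a : ℕ → ℕ) : Prop := ∀ i, 1 ≤ i → i < m → a i < q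
def mu (m : ℕ) (a : ℕ → ℕ) : ℕ := ∑ i ∈ Finset.range m, a i * (i+1)
def mono {B : Type*} [CommRing B] (m : ℕ) (y : ℕ → B) (a : ℕ → ℕ) : B :=
  ∏ i ∈ Finset.range m, y (i+1) ^ a i

def Rel {B : Type*} [CommRing B] (q : ℕ) (y : ℕ → B) : Prop :=
  y 0 = 1 ∧ ∀ i, y (i+1) ^ q = y (i+1) + (y 1 ^ q - y 1) * y i

lemma gsum_succ (q i : ℕ) : gsum q (i+1) = gsum q i + q^(i+1) := by
  simp [gsum, Finset.sum_range_succ]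

lemma gsum_zero (q : ℕ) : gsum q 0 = 1 := by simp [gsum]

lemma gsum_pos (q i : ℕ) : 1 ≤ gsum q i := by
  induction i with
  | zero => simp [gsum_zero]
  | succ i ih => rw [gsum_succ]; omega

lemma wt_rec {q m i : ℕ} (h : i + 1 < m) : q * wt q m (i+1) = q * wt q m 0 + wt q m i := by
  obtain ⟨e, rfl⟩ := Nat.exists_eq_add_of_lt h
  unfold wt
  rw [show i + 1 + e + 1 - 1 - (i+1) = e by omega, show i + 1 + e + 1 - 1 - 0 = i+1+e by omega,
    show i + 1 + e + 1 - 1 - i = e+1 by omega, gsum_succ, gsum_zero]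
  ring

lemma wt_succ {q m i : ℕ} (h : i < m) : wt q (m+1) i = q * wt q m i := by
  unfold wt
  rw [show m + 1 - 1 - i = (m-1-i)+1 by omega]; ring

lemma gsum_succ' (q i : ℕ) : gsum q (i+1) = 1 + q * gsum q i := by
  induction i with
  | zero => simp [gsum, Finset.sum_range_succ]
  | succ i ih => 
    conv_rhs => rw [gsum_succ q i]
    rw [gsum_succ q (i+1), ih]; ring

lemma wt_mono {q m i : ℕ} (h : i + 1 < m) : wt q m i ≤ wt q m (i+1) := by
  obtain ⟨e, rfl⟩ := Nat.exists_eq_add_of_lt h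
  unfold wt
  rw [show i + 1 + e + 1 - 1 - (i+1) = e by omega,
    show i + 1 + e + 1 - 1 - i = e+1 by omega, gsum_succ', pow_succ, mul_assoc]
  gcongr
  omega

lemma wt_mono' {q m i j : ℕ} (hij : i ≤ j) (h : j < m) : wt q m i ≤ wt q m j := by
  induction j, hij using Nat.le_induction with
  | base => exact le_rfl
  | succ j hj ih => exact (ih (by omega)).trans (wt_mono h)

lemma W_add (q m : ℕ) (a b : ℕ → ℕ) : W q m (a+b) = W q m a + W q m b := by
  simp [W, add_mul, Finset.sum_add_distrib]

lemma W_single {q m i : ℕ} (h : i < m) (c : ℕ) : W q m (Pi.single i c) = c * wt q m i := by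
  unfold W
  rw [Finset.sum_eq_single i]
  · simp
  · intro j _ hj; simp [Pi.single_eq_of_ne hj]
  · intro h'; simp at h'; omega

lemma mu_add (m : ℕ) (a b : ℕ → ℕ) : mu m (a+b) = mu m a + mu m b := by
  simp [mu, add_mul, Finset.sum_add_distrib]

lemma mu_single {m i : ℕ} (h : i < m) (c : ℕ) : mu m (Pi.single i c) = c * (i+1) := by
  unfold mu
  rw [Finset.sum_eq_single i]
  · simp
  · intro j _ hj; simp [Pi.single_eq_of_ne hj]
  · intro h'; simp at h'; omega

section
variable {B : Type*} [CommRing B]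

lemma mono_add (m : ℕ) (y : ℕ → B) (a b : ℕ → ℕ) : mono m y (a+b) = mono m y a * mono m y b := by
  simp [mono, pow_add, Finset.prod_mul_distrib]

lemma mono_single {m i : ℕ} (y : ℕ → B) (h : i < m) (c : ℕ) :
    mono m y (Pi.single i c) = y (i+1) ^ c := by
  unfold mono
  rw [Finset.prod_eq_single i]
  · simp
  · intro j _ hj; simp [Pi.single_eq_of_ne hj]
  · intro h'; simp at h'; omega

lemma mono_congr {m : ℕ} (y : ℕ → B) {a b : ℕ → ℕ} (h : ∀ i < m, a i = b i) :
    mono m y a = mono m y b := by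
  unfold mono
  refine Finset.prod_congr rfl fun i hi => ?_
  rw [h i (by simpa using hi)]

end

lemma W_succ (q m : ℕ) (a : ℕ → ℕ) : W q (m+1) a = q * W q m a + a m * gsum q m := by
  unfold W
  rw [Finset.sum_range_succ, Finset.mul_sum]
  congr 1
  · refine Finset.sum_congr rfl fun i hi => ?_
    rw [wt_succ (by simpa using hi)]; ring
  · simp [wt]

lemma gsum_mod (q i : ℕ) : ∃ c, gsum q i = 1 + q * c := by
  induction i with
  | zero => exact ⟨0, by simp [gsum_zero]⟩
  | succ i ih =>
    obtain ⟨c, hc⟩ := ih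
    exact ⟨c + q^i, by rw [gsum_succ, hc]; ring⟩

lemma W_inj {q : ℕ} (hq : 2 ≤ q) (m : ℕ) {a b : ℕ → ℕ} (ha : Red q m a) (hb : Red q m b)
    (h : W q m a = W q m b) : ∀ i < m, a i = b i := by
  induction m with
  | zero => intro i hi; omega
  | succ m ih =>
    rw [W_succ, W_succ] at h
    have key : a m = b m := by
      rcases Nat.eq_zero_or_pos m with rfl | hm
      · simpa [W, gsum_zero] using h
      · obtain ⟨c, hc⟩ := gsum_mod q m
        have h1 := congrArg (· % q) h
        simp only [hc] at h1
        rw [show q * W q m a + a m * (1 + q*c) = a m + q * (W q m a + a m * c) by ring,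
          show q * W q m b + b m * (1 + q*c) = b m + q * (W q m b + b m * c) by ring,
          Nat.add_mul_mod_self_left, Nat.add_mul_mod_self_left,
          Nat.mod_eq_of_lt (ha m hm (by omega)), Nat.mod_eq_of_lt (hb m hm (by omega))] at h1
        exact h1
    rw [key] at h
    have h2 : W q m a = W q m b := Nat.eq_of_mul_eq_mul_left (by omega) (Nat.add_right_cancel h)
    intro i hi
    rcases Nat.lt_succ_iff_lt_or_eq.mp hi with h' | rfl
    · exact ih (fun i h1 h2 => ha i h1 (by omega)) (fun i h1 h2 => hb i h1 (by omega)) h2 i h'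
    · exact key

lemma W_surj {q : ℕ} (hq : 2 ≤ q) (m : ℕ) (hm : 1 ≤ m) :
    ∃ g, ∀ t ≥ g, ∃ a, Red q m a ∧ W q m a = t := by
  induction m, hm using Nat.le_induction with
  | base =>
    refine ⟨0, fun t _ => ⟨fun _ => t, fun i h1 h2 => by omega, ?_⟩⟩
    simp [W, wt, gsum_zero]
  | succ m hm ih =>
    obtain ⟨g, hg⟩ := ih
    obtain ⟨c, hc⟩ := gsum_mod q m
    refine ⟨q * (g + q * c + 1), fun t ht => ?_⟩
    have hr : t % q < q := Nat.mod_lt _ (by omega)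
    have h1 : t % q * c ≤ q * c := Nat.mul_le_mul_right _ hr.le
    have h2 : g + q * c + 1 ≤ t / q := by rw [Nat.le_div_iff_mul_le (by omega)]; linarith
    obtain ⟨a, ha, hW⟩ := hg (t / q - t % q * c) (by omega)
    refine ⟨Function.update a m (t % q), ?_, ?_⟩
    · intro i h1 h2
      rcases Nat.lt_succ_iff_lt_or_eq.mp h2 with h' | rfl
      · rw [Function.update_of_ne (by omega)]; exact ha i h1 h'
      · simpa using hr
    · rw [W_succ]
      have : W q m (Function.update a m (t % q)) = W q m a := by
        unfold W
        refine Finset.sum_congr rfl fun i hi => ?_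
        rw [Function.update_of_ne (by simp at hi; omega)]
      rw [this, hW, hc, Function.update_self, Nat.mul_sub]
      have h3 : q * (t % q * c) ≤ q * (t / q) := Nat.mul_le_mul_left _ (by omega)
      have h4 := Nat.div_add_mod t q
      zify [h3] at *
      linarith

open Classical in
def H (q m : ℕ) : Set ℕ := {t | ∃ a, Red q m a ∧ W q m a = t}

open Classical in
noncomputable def ex (q m t : ℕ) : ℕ → ℕ := if h : t ∈ H q m then h.choose else 0

lemma ex_red {q m t : ℕ} (h : t ∈ H q m) : Red q m (ex q m t) := by
  unfold ex; rw [dif_pos h]; exact h.choose_spec.1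
lemma ex_W {q m t : ℕ} (h : t ∈ H q m) : W q m (ex q m t) = t := by
  unfold ex; rw [dif_pos h]; exact h.choose_spec.2

noncomputable def M {B : Type*} [CommRing B] (q m : ℕ) (y : ℕ → B) (t : ℕ) : B := mono m y (ex q m t)

lemma mono_mem {F B : Type*} [Field F] [CommRing B] [Algebra F B] {q m : ℕ} (hq : 2 ≤ q)
    {y : ℕ → B} (hy : Rel q y) (a : ℕ → ℕ) :
    mono m y a ∈ Submodule.span F (M q m y '' {h | h ∈ H q m ∧ h ≤ W q m a}) := by
  induction hn : mu m a using Nat.strong_induction_on generalizing a with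
  | _ n ih =>
  by_cases hr : Red q m a
  · apply Submodule.subset_span
    refine ⟨W q m a, ⟨⟨a, hr, rfl⟩, le_rfl⟩, ?_⟩
    have hH : W q m a ∈ H q m := ⟨a, hr, rfl⟩
    exact mono_congr y (W_inj hq m (ex_red hH) hr (ex_W hH))
  · unfold Red at hr
    push Not at hr
    obtain ⟨i, h1, him, hia⟩ := hr
    obtain ⟨j, rfl⟩ : ∃ j, i = j+1 := ⟨i-1, by omega⟩
    set a' : ℕ → ℕ := Function.update a (j+1) (a (j+1) - q) with ha'
    have haa : a = a' + Pi.single (j+1) q := by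
      funext i
      by_cases h : i = j+1
      · subst h; simp [ha']; omega
      · simp [ha', h]
    have e1 : mono m y a = mono m y (a' + Pi.single (j+1) 1)
        + mono m y (a' + Pi.single 0 q + Pi.single j 1)
        - mono m y (a' + Pi.single 0 1 + Pi.single j 1) := by
      rw [haa]
      simp only [mono_add]
      rw [mono_single y him, mono_single y him, mono_single y (show j < m by omega),
        mono_single y (show 0 < m by omega), mono_single y (show 0 < m by omega), hy.2 (j+1)]
      ring
    have hW := W_single (q := q) him q
    have hW1 := W_single (q := q) him 1
    have hW2 := W_single (q := q) (show 0 < m by omega) q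
    have hW3 := W_single (q := q) (show 0 < m by omega) 1
    have hW4 := W_single (q := q) (show j < m by omega) 1
    have hWr := wt_rec (q := q) him
    have hwa : W q m a = W q m a' + q * wt q m (j+1) := by
      conv_lhs => rw [haa]
      rw [W_add, hW]
    have hma : mu m a = mu m a' + q * (j+1+1) := by
      conv_lhs => rw [haa]
      rw [mu_add, mu_single him]
    have hqq : ∀ z, z ≤ q * z := fun z => Nat.le_mul_of_pos_left z (by omega)
    rw [e1]
    have go : ∀ b, mu m b < mu m a → W q m b ≤ W q m a →
        mono m y b ∈ Submodule.span F (M q m y '' {h | h ∈ H q m ∧ h ≤ W q m a}) := by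
      intro b hb1 hb2
      refine Submodule.span_mono (Set.image_mono ?_) (ih (mu m b) (by omega) b rfl)
      rintro h ⟨h1, h2⟩; exact ⟨h1, h2.trans hb2⟩
    have hqj : 2 * (j + 1) ≤ q * (j+1) := Nat.mul_le_mul_right _ hq
    refine Submodule.sub_mem _ (Submodule.add_mem _ (go _ ?_ ?_) (go _ ?_ ?_)) (go _ ?_ ?_)
    · rw [mu_add, mu_single him, hma]; nlinarith
    · rw [W_add, hW1, hwa]; have := hqq (wt q m (j+1)); omega
    · rw [mu_add, mu_add, mu_single (show 0 < m by omega), mu_single (show j < m by omega), hma]; nlinarith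
    · rw [W_add, W_add, hW2, hW4, hwa]; omega
    · rw [mu_add, mu_add, mu_single (show 0 < m by omega), mu_single (show j < m by omega), hma]; nlinarith
    · rw [W_add, W_add, hW3, hW4, hwa]; have := hqq (wt q m 0); omega

end St

namespace St

section
variable (F : Type*) {B : Type*} [Field F] [CommRing B] [Algebra F B]

def Fil (q m : ℕ) (y : ℕ → B) (t : ℕ) : Submodule F B :=
  Submodule.span F (mono m y '' {a | W q m a ≤ t})

variable {F}

lemma Fil_mono {q m : ℕ} {y : ℕ → B} {s t : ℕ} (h : s ≤ t) : Fil F q m y s ≤ Fil F q m y t :=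
  Submodule.span_mono (Set.image_mono fun _ ha => le_trans ha h)

lemma mono_mem_Fil {q m : ℕ} {y : ℕ → B} (a : ℕ → ℕ) : mono m y a ∈ Fil F q m y (W q m a) :=
  Submodule.subset_span ⟨a, by simp, rfl⟩

lemma one_mem_Fil {q m : ℕ} {y : ℕ → B} (t : ℕ) : (1 : B) ∈ Fil F q m y t := by
  refine Submodule.subset_span ⟨0, ?_, ?_⟩
  · simp [W]
  · simp [mono]

lemma Fil_mul {q m : ℕ} {y : ℕ → B} {s t : ℕ} {x z : B} (hx : x ∈ Fil F q m y s)
    (hz : z ∈ Fil F q m y t) : x * z ∈ Fil F q m y (s+t) := by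
  have : Fil F q m y s * Fil F q m y t ≤ Fil F q m y (s+t) := by
    unfold Fil
    rw [Submodule.span_mul_span]
    apply Submodule.span_mono
    rintro _ ⟨_, ⟨a, ha, rfl⟩, _, ⟨b, hb, rfl⟩, rfl⟩
    refine ⟨a + b, ?_, mono_add m y a b⟩
    simp only [Set.mem_ofPred_eq] at ha hb ⊢
    rw [W_add]; omega
  exact this (Submodule.mul_mem_mul hx hz)

lemma Fil_pow {q m : ℕ} {y : ℕ → B} {s : ℕ} {x : B} (hx : x ∈ Fil F q m y s) (n : ℕ) :
    x ^ n ∈ Fil F q m y (n * s) := by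
  induction n with
  | zero => simpa using one_mem_Fil 0
  | succ n ih => rw [pow_succ, add_mul, one_mul]; exact Fil_mul ih hx

lemma Fil_prod {q m : ℕ} {y : ℕ → B} {ι : Type*} (S : Finset ι) (f : ι → B) (w : ι → ℕ)
    (h : ∀ i ∈ S, f i ∈ Fil F q m y (w i)) : ∏ i ∈ S, f i ∈ Fil F q m y (∑ i ∈ S, w i) := by
  classical
  induction S using Finset.induction_on with
  | empty => simpa using one_mem_Fil 0
  | insert a S ha ih =>
    rw [Finset.prod_insert ha, Finset.sum_insert ha]
    exact Fil_mul (h a (by simp)) (ih fun i hi => h i (by simp [hi]))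

lemma Fil_le {q m : ℕ} (hq : 2 ≤ q) {y : ℕ → B} (hy : Rel q y) (t : ℕ) :
    Fil F q m y t ≤ Submodule.span F (M q m y '' {h | h ∈ H q m ∧ h ≤ t}) := by
  refine Submodule.span_le.mpr ?_
  rintro _ ⟨a, ha, rfl⟩
  refine Submodule.span_mono (Set.image_mono ?_) (mono_mem hq hy a)
  rintro h ⟨h1, h2⟩
  exact ⟨h1, h2.trans ha⟩

lemma y_mem_Fil {q m : ℕ} {y : ℕ → B} {i : ℕ} (hi : i < m) : y (i+1) ∈ Fil F q m y (wt q m i) := by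
  have := mono_mem_Fil (F := F) (q := q) (m := m) (y := y) (Pi.single i 1)
  rwa [mono_single y hi, W_single hi, one_mul, pow_one] at this

/-- twist by g -/
def tw (g : ℕ → F) (y : ℕ → B) (i : ℕ) : B :=
  ∑ x ∈ Finset.HasAntidiagonal.antidiagonal i, algebraMap F B (g x.1) * y x.2

lemma tw_mem {q m : ℕ} {y : ℕ → B} (hy : y 0 = 1) (g : ℕ → F) {i : ℕ} (hi : i < m) :
    tw g y (i+1) ∈ Fil F q m y (wt q m i) := by
  refine Submodule.sum_mem _ fun x hx => ?_
  rw [← Algebra.smul_def]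
  refine Submodule.smul_mem _ _ ?_
  have := Finset.HasAntidiagonal.mem_antidiagonal.mp hx
  rcases h : x.2 with _ | j
  · rw [hy]; exact one_mem_Fil _
  · exact Fil_mono (wt_mono' (by omega) hi) (y_mem_Fil (by omega))

lemma mono_tw_mem {q m : ℕ} {y : ℕ → B} (hy : y 0 = 1) (g : ℕ → F) (a : ℕ → ℕ) :
    mono m (tw g y) a ∈ Fil F q m y (W q m a) := by
  refine Fil_prod _ _ _ fun i hi => Fil_pow (tw_mem hy g (by simpa using hi)) _

lemma M_mem_Fil {q m : ℕ} {y : ℕ → B} {h : ℕ} (hh : h ∈ H q m) : M q m y h ∈ Fil F q m y h := by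
  have := mono_mem_Fil (F := F) (q := q) (m := m) (y := y) (ex q m h)
  rwa [ex_W hh] at this

open Classical in
noncomputable def Hf (q m t : ℕ) : Finset ℕ := (Finset.range (t+1)).filter (· ∈ H q m)

lemma mem_Hf {q m t h : ℕ} : h ∈ Hf q m t ↔ h ∈ H q m ∧ h ≤ t := by
  simp [Hf, and_comm]

lemma card_Hf_le (q m t : ℕ) : (Hf q m t).card ≤ t + 1 := by
  classical
  refine (Finset.card_filter_le _ _).trans (by simp)

lemma card_Hf_ge {q : ℕ} (hq : 2 ≤ q) (m : ℕ) (hm : 1 ≤ m) :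
    ∃ g, ∀ t, t + 1 ≤ (Hf q m t).card + g := by
  obtain ⟨g, hg⟩ := W_surj hq m hm
  refine ⟨g, fun t => ?_⟩
  have : Finset.range (t+1) ⊆ Hf q m t ∪ Finset.range g := by
    intro x hx
    simp only [Finset.mem_union, mem_Hf, Finset.mem_range] at hx ⊢
    by_cases h : x < g
    · right; exact h
    · left; exact ⟨hg x (by omega), by omega⟩
  have h2 := (Finset.card_le_card this).trans (Finset.card_union_le _ _)
  simpa using h2

lemma Fil_le' {q m : ℕ} (hq : 2 ≤ q) {y : ℕ → B} (hy : Rel q y) (t : ℕ) :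
    ∃ V : Submodule F B, Fil F q m y t ≤ V ∧ Module.Finite F V ∧ Module.finrank F V ≤ t + 1 := by
  classical
  refine ⟨Submodule.span F ((Hf q m t).image (M q m y)), ?_, ?_, ?_⟩
  · refine (Fil_le hq hy t).trans (Submodule.span_mono ?_)
    rintro _ ⟨h, hh, rfl⟩
    simp only [Finset.coe_image]
    exact ⟨h, by simpa using mem_Hf.mpr hh, rfl⟩
  · infer_instance
  · exact (finrank_span_finset_le_card _).trans (Finset.card_image_le.trans (card_Hf_le _ _ _))

/-- too many vectors in `Fil` are dependent -/
lemma card_le_of_indep {q m : ℕ} (hq : 2 ≤ q) {y : ℕ → B} (hy : Rel q y) (t : ℕ) {ι : Type*} [Fintype ι]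
    (v : ι → B) (hv : ∀ i, v i ∈ Fil F q m y t) (hl : LinearIndependent F v) :
    Fintype.card ι ≤ t + 1 := by
  obtain ⟨V, h1, h2, h3⟩ := Fil_le' (F := F) (m := m) hq hy t
  have : LinearIndependent F (fun i => (⟨v i, h1 (hv i)⟩ : V)) := by
    apply LinearIndependent.of_comp V.subtype
    exact hl
  exact (this.fintype_card_le_finrank).trans h3

end
end St

namespace St

lemma exists_val (K : Type*) [Field K] (Ω : Type*) [Field Ω] [Algebra K Ω] (s : Ω)
    (hs : Transcendental K s) :
    ∃ B : ValuationSubring Ω, (∀ c : K, c ≠ 0 → B.valuation (algebraMap K Ω c) = 1) ∧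
      B.valuation s < 1 := by
  let φ : K[X] →+* Ω := (aeval s : K[X] →ₐ[K] Ω).toRingHom
  have hinj : Function.Injective φ := transcendental_iff_injective.mp hs
  let e := RingEquiv.ofLeftInverse (f := φ) (g := Function.invFun φ) (Function.leftInverse_invFun hinj)
  let I : Ideal φ.range := Ideal.comap e.symm.toRingHom (Ideal.span {X})
  have hI : I ≠ ⊤ := by
    apply Ideal.comap_ne_top
    intro h
    rw [Ideal.span_singleton_eq_top] at h
    exact Polynomial.not_isUnit_X h
  obtain ⟨B, hB, hB2⟩ := Ideal.image_subset_nonunits_valuationSubring I hI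
  refine ⟨B, fun c hc => ?_, ?_⟩
  · have hle : ∀ c : K, B.valuation (algebraMap K Ω c) ≤ 1 := by
      intro c
      rw [B.valuation_le_one_iff]
      exact hB ⟨C c, by simp [φ]⟩
    refine le_antisymm (hle c) ?_
    have h1 := hle c⁻¹
    rw [map_inv₀, map_inv₀] at h1
    have h0 : B.valuation (algebraMap K Ω c) ≠ 0 := by
      simpa using hc
    exact (inv_le_one₀ (zero_lt_iff.mpr h0)).mp h1
  · rw [← B.mem_nonunits_iff]
    apply hB2
    refine ⟨⟨s, ⟨X, by simp [φ]⟩⟩, ?_, rfl⟩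
    change e.symm _ ∈ Ideal.span {X}
    have : e.symm ⟨s, ⟨X, by simp [φ]⟩⟩ = X := by
      rw [RingEquiv.symm_apply_eq]
      apply Subtype.ext
      rw [RingEquiv.ofLeftInverse_apply]
      simp [φ]
    rw [this]
    exact Ideal.subset_span rfl

lemma indep_of_val {K Ω : Type*} [Field K] [Field Ω] [Algebra K Ω] {Γ : Type*}
    [LinearOrderedCommGroupWithZero Γ] (v : Valuation Ω Γ)
    (hv : ∀ c : K, c ≠ 0 → v (algebraMap K Ω c) = 1) {ι : Type*} (f : ι → Ω) (h0 : ∀ i, f i ≠ 0)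
    (hf : Function.Injective fun i => v (f i)) : LinearIndependent K f := by
  classical
  rw [linearIndependent_iff']
  intro s g hg i hi
  by_contra hgi
  set t := s.filter (fun i => g i ≠ 0) with ht
  have hsum : ∑ i ∈ t, g i • f i = 0 := by
    rw [← hg, ht, Finset.sum_filter]
    refine Finset.sum_congr rfl fun j _ => ?_
    split_ifs with h
    · rfl
    · push Not at h; simp [h]
  have hvv : ∀ j ∈ t, v (g j • f j) = v (f j) := by
    intro j hj
    rw [Algebra.smul_def, map_mul, hv _ (Finset.mem_filter.mp hj).2, one_mul]
  obtain ⟨j, hj, hmax⟩ := Finset.exists_max_image t (fun j => v (f j)) ⟨i, by simp [ht, hi, hgi]⟩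
  have h1 : v (∑ i ∈ t, g i • f i) = v (g j • f j) := by
    apply Valuation.map_sum_eq_of_lt v hj
    · intro k hk
      simp only [Finset.mem_sdiff, Finset.mem_singleton] at hk
      rw [hvv j hj, hvv k hk.1]
      exact lt_of_le_of_ne (hmax k hk.1) fun h => hk.2 (hf h)
  rw [hsum, map_zero, hvv j hj] at h1
  exact h0 j (by simpa using h1.symm)

universe u

theorem exists_omega (K : Type u) [Field K] (q : ℕ) (hq : 2 ≤ q) :
    ∃ (Ω : Type u) (_ : Field Ω) (_ : Algebra K Ω) (Y : ℕ → Ω), Rel q Y ∧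
      ∀ m, 1 ≤ m → ∀ (ι : Type) (a : ι → ℕ → ℕ), (Function.Injective fun i => W q m (a i)) →
        LinearIndependent K (fun i => mono m Y (a i)) := by
  let Ω := AlgebraicClosure (RatFunc K)
  let s : Ω := algebraMap (RatFunc K) Ω RatFunc.X
  have hs : Transcendental K s := by
    have := RatFunc.transcendental_X (K := K)
    exact (transcendental_algebraMap_iff (FaithfulSMul.algebraMap_injective (RatFunc K) Ω)).mpr this
  obtain ⟨B, hB1, hB2⟩ := exists_val K Ω s hs
  set v := B.valuation with hv
  have hs0 : s ≠ 0 := by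
    rintro h; rw [h] at hs
    exact hs (isAlgebraic_zero)
  have hv1 : 1 < v s⁻¹ := by
    rw [map_inv₀, one_lt_inv₀ (zero_lt_iff.mpr (by simpa using hs0))]; exact hB2
  have hex : ∀ c : Ω, ∃ z : Ω, z ^ q = z + c := by
    intro c
    have hd : (X ^ q - (X + C c) : Polynomial Ω).degree ≠ 0 := by
      rw [Polynomial.degree_sub_eq_left_of_degree_lt]
      · rw [degree_X_pow]; norm_cast; omega
      · rw [degree_X_pow, degree_X_add_C]; norm_cast
    obtain ⟨z, hz⟩ := IsAlgClosed.exists_root _ hd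
    refine ⟨z, ?_⟩
    simp [IsRoot] at hz
    linear_combination hz
  choose rt hrt using hex
  let t : Ω := s⁻¹
  let Y' : ℕ → Ω := fun n => Nat.rec t (fun _ z => rt ((t ^ q - t) * z)) n
  let Y : ℕ → Ω := fun n => Nat.casesOn n 1 Y'
  have hY1 : Y 1 = t := rfl
  have hYs : ∀ n, Y (n+2) = rt ((t ^ q - t) * Y (n+1)) := fun n => rfl
  have hrel : Rel q Y := by
    refine ⟨rfl, fun i => ?_⟩
    rcases i with _ | i
    · change t ^ q = t + (t^q - t) * 1; ring
    · rw [hYs, hrt, hY1]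
  have hvt : v (t ^ q - t) = v t ^ q := by
    rw [Valuation.map_sub_eq_of_lt_left, map_pow]
    rw [map_pow]
    exact lt_self_pow₀ hv1 (by omega)
  have hstep : ∀ i, 1 < v (Y (i+1)) ∧ v (Y (i+1)) ^ (q^i) = v t ^ gsum q i := by
    intro i
    induction i with
    | zero => simp [hY1, gsum_zero]; exact hv1
    | succ i ih =>
      have e1 := hrt ((t ^ q - t) * Y (i+1))
      rw [← hYs i] at e1
      have e2 : v (Y (i+2) ^ q - Y (i+2)) = v t ^ q * v (Y (i+1)) := by
        rw [e1, add_sub_cancel_left, map_mul, hvt]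
      have e3 : 1 < v t ^ q * v (Y (i+1)) :=
        one_lt_mul_of_lt_of_le' (one_lt_pow₀ hv1 (by omega)) ih.1.le
      have e4 : 1 < v (Y (i+2)) := by
        by_contra hcon
        push Not at hcon
        have : v (Y (i+2) ^ q - Y (i+2)) ≤ 1 := by
          refine (Valuation.map_sub _ _ _).trans (max_le ?_ hcon)
          rw [map_pow]; exact pow_le_one' hcon _
        rw [e2] at this
        exact absurd e3 (not_lt.mpr this)
      have e5 : v (Y (i+2)) ^ q = v t ^ q * v (Y (i+1)) := by
        rw [← e2, Valuation.map_sub_eq_of_lt_left, map_pow]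
        rw [map_pow]
        exact lt_self_pow₀ e4 (by omega)
      refine ⟨e4, ?_⟩
      rw [pow_succ' q i, pow_mul, e5, mul_pow, ih.2, gsum_succ, ← pow_mul, ← pow_add, pow_succ' q i, add_comm]
  refine ⟨Ω, inferInstance, inferInstance, Y, hrel, fun m hm ι a ha => ?_⟩
  have hvm : ∀ a, v (mono m Y a) ^ (q^(m-1)) = v t ^ (W q m a) := by
    intro a
    unfold mono W
    rw [map_prod, ← Finset.prod_pow, ← Finset.prod_pow_eq_pow_sum]
    refine Finset.prod_congr rfl fun i hi => ?_
    have hi : i < m := by simpa using hi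
    rw [map_pow, ← pow_mul, wt, show q^(m-1) = q^i * q^(m-1-i) by rw [← pow_add]; congr 1; omega,
      show a i * (q^i * q^(m-1-i)) = q^i * (a i * q^(m-1-i)) by ring, pow_mul, (hstep i).2, ← pow_mul]
    congr 1; ring
  refine indep_of_val v hB1 _ (fun i h => ?_) (fun i j hij => ?_)
  · have := hvm (a i)
    rw [h, map_zero, zero_pow (by positivity)] at this
    exact (pow_ne_zero _ (zero_lt_one.trans hv1).ne') this.symm
  · apply ha
    simp only at hij ⊢
    have h1 := hvm (a i)
    rw [hij, hvm (a j)] at h1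
    exact (pow_right_injective₀ (zero_lt_one.trans hv1) hv1.ne' h1).symm

end St

namespace St

set_option linter.unusedSectionVars false

section
variable {F K Ω : Type*} [Field F] [Fintype F] [Field K] [Algebra F K] [Field Ω] [Algebra K Ω]
  [Algebra F Ω] [IsScalarTower F K Ω]

def yy (Y : ℕ → Ω) (S : Finset (ℕ → K)) (i : ℕ) : Ω × (S → K) := (Y i, fun P => P.1 i)

lemma yy_rel {q : ℕ} {Y : ℕ → Ω} (hY : Rel q Y) {S : Finset (ℕ → K)} (hS : ∀ P ∈ S, Rel q P) :
    Rel q (yy Y S) := by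
  refine ⟨Prod.ext hY.1 (funext fun P => (hS P.1 P.2).1), fun i => ?_⟩
  refine Prod.ext (hY.2 i) (funext fun P => (hS P.1 P.2).2 i)

lemma mono_fst (m : ℕ) (Y : ℕ → Ω) (S : Finset (ℕ → K)) (a : ℕ → ℕ) :
    (mono m (yy Y S) a).1 = mono m Y a := by
  simp [mono, yy, Prod.fst_prod]

lemma mono_snd (m : ℕ) (Y : ℕ → Ω) (S : Finset (ℕ → K)) (a : ℕ → ℕ) (P : S) :
    (mono m (yy Y S) a).2 P = mono m P.1 a := by
  simp [mono, yy, Prod.snd_prod]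

lemma tw_snd (g : ℕ → F) (m : ℕ) (Y : ℕ → Ω) (S : Finset (ℕ → K)) (a : ℕ → ℕ) (P : S) :
    (mono m (tw g (yy Y S)) a).2 P = mono m (tw g P.1) a := by
  simp [mono, yy, Prod.snd_prod, tw, Prod.snd_sum]

lemma Fil_restrict {B : Type*} [CommRing B] [Algebra F B] [Algebra K B] [IsScalarTower F K B]
    {q m : ℕ} {y : ℕ → B} {t : ℕ} {b : B} (h : b ∈ Fil F q m y t) : b ∈ Fil K q m y t := by
  have : Fil F q m y t ≤ (Fil K q m y t).restrictScalars F := by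
    unfold Fil
    rw [Submodule.span_le]
    exact Submodule.subset_span
  exact this h

def LI (K : Type*) {Ω : Type*} [Field K] [Field Ω] [Algebra K Ω] (q m : ℕ) (Y : ℕ → Ω) : Prop :=
  ∀ (ι : Type) (a : ι → ℕ → ℕ), (Function.Injective fun i => W q m (a i)) →
        LinearIndependent K (fun i => mono m Y (a i))

lemma exists_frob (q : ℕ) (hq : Fintype.card F = q) (ν : ℕ) : ∃ φ : K →ₐ[F] K, ∀ x, φ x = x ^ (q^ν) := by
  induction ν with
  | zero => exact ⟨AlgHom.id F K, fun x => by simp⟩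
  | succ n ih =>
    obtain ⟨φ, hφ⟩ := ih
    refine ⟨(FiniteField.frobeniusAlgHom F K).comp φ, fun x => ?_⟩
    simp [hφ, hq, pow_succ, pow_mul]

open Classical in
lemma sep {q m : ℕ} (Y : ℕ → Ω) {S : Finset (ℕ → K)} (hS : ∀ P ∈ S, Rel q P)
    (hd : ∀ P ∈ S, ∀ P' ∈ S, (∀ i ≤ m, P i = P' i) → P = P') (P : S) :
    ∃ b ∈ Fil K q m (yy Y S) (S.card * wt q m (m-1)), ∀ P', b.2 P' = if P = P' then 1 else 0 := by
  classical
  have h1 : ∀ P' : S, P' ≠ P → ∃ b ∈ Fil K q m (yy Y S) (wt q m (m-1)), b.2 P = 1 ∧ b.2 P' = 0 := by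
    intro P' hne
    have : ¬ ∀ i ≤ m, P.1 i = P'.1 i := fun h => hne (Subtype.ext (hd _ P.2 _ P'.2 h)).symm
    push Not at this
    obtain ⟨i, him, hi⟩ := this
    obtain ⟨j, rfl⟩ : ∃ j, i = j+1 := by
      rcases i with _ | j
      · exact absurd ((hS _ P.2).1.trans (hS _ P'.2).1.symm) hi
      · exact ⟨j, rfl⟩
    refine ⟨(P.1 (j+1) - P'.1 (j+1))⁻¹ • (yy Y S (j+1) - P'.1 (j+1) • (1 : Ω × (S → K))), ?_, ?_, ?_⟩
    · refine Submodule.smul_mem _ _ (Submodule.sub_mem _ ?_ (Submodule.smul_mem _ _ (one_mem_Fil _)))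
      exact Fil_mono (wt_mono' (by omega) (by omega)) (y_mem_Fil (by omega))
    · simp [yy]; exact inv_mul_cancel₀ (sub_ne_zero.mpr hi)
    · simp [yy]
  choose! f hf1 hf2 hf3 using h1
  refine ⟨∏ P' ∈ Finset.univ.erase P, f P', ?_, fun P' => ?_⟩
  · have := Fil_prod (F := K) (q := q) (m := m) (y := yy Y S) (Finset.univ.erase P) f
      (fun _ => wt q m (m-1)) (fun i hi => hf1 i (Finset.ne_of_mem_erase hi))
    refine Fil_mono ?_ this
    rw [Finset.sum_const, smul_eq_mul]
    refine Nat.mul_le_mul_right _ ((Finset.card_erase_le).trans (by simp))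
  · rw [Prod.snd_prod, Finset.prod_apply]
    split_ifs with h
    · subst h
      exact Finset.prod_eq_one fun i hi => hf2 i (Finset.ne_of_mem_erase hi)
    · exact Finset.prod_eq_zero (i := P') (by simp [Ne.symm h]) (hf3 P' (Ne.symm h))

/-- number of zeros is bounded by degree -/
lemma zeros_le {q m : ℕ} (hq : 2 ≤ q) {Y : ℕ → Ω} (hY : Rel q Y) (hLI : LI K q m Y)
    {g0 : ℕ} (hg0 : ∀ t, t + 1 ≤ (Hf q m t).card + g0)
    {S : Finset (ℕ → K)} (hS : ∀ P ∈ S, Rel q P)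
    (hd : ∀ P ∈ S, ∀ P' ∈ S, (∀ i ≤ m, P i = P' i) → P = P')
    {D : ℕ} {Ψ : Ω × (S → K)} (hΨ : Ψ ∈ Fil K q m (yy Y S) D) (h1 : Ψ.1 ≠ 0) (h2 : ∀ P, Ψ.2 P = 0) :
    S.card ≤ D + g0 := by
  classical
  choose δ hδ1 hδ2 using sep (Ω := Ω) (q := q) (m := m) Y hS hd
  set t := S.card * wt q m (m-1) with ht
  let v : S ⊕ Hf q m t → Ω × (S → K) := Sum.elim δ (fun h => Ψ * M q m (yy Y S) h.1)
  have hv : ∀ i, v i ∈ Fil K q m (yy Y S) (D + t) := by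
    rintro (P | h)
    · exact Fil_mono (by omega) (hδ1 P)
    · exact Fil_mono (by have := (mem_Hf.mp h.2).2; omega) (Fil_mul hΨ (M_mem_Fil (mem_Hf.mp h.2).1))
  have hl : LinearIndependent K v := by
    rw [Fintype.linearIndependent_iff]
    intro c hc
    rw [Fintype.sum_sum_type] at hc
    have hP : ∀ P, c (Sum.inl P) = 0 := by
      intro P
      have := congrFun (congrArg Prod.snd hc) P
      simpa [v, Prod.snd_sum, Finset.sum_apply, hδ2, h2] using this
    have h4 : ∑ h : Hf q m t, c (Sum.inr h) • mono m Y (ex q m h.1) = 0 := by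
      have := congrArg Prod.fst hc
      simp only [hP, zero_smul, Finset.sum_const_zero, zero_add, v, Sum.elim_inr, Prod.fst_sum,
        Prod.smul_fst, Prod.fst_mul, M, mono_fst, Prod.fst_zero] at this
      have e : Ψ.1 * ∑ h : Hf q m t, c (Sum.inr h) • mono m Y (ex q m h.1) = 0 := by
        rw [← this, Finset.mul_sum]
        refine Finset.sum_congr rfl fun x _ => ?_
        rw [mul_smul_comm]
      exact (mul_eq_zero.mp e).resolve_left h1
    have hl := hLI (Hf q m t) (fun h => ex q m h.1) (by
      intro x z hxz
      simp only [ex_W (mem_Hf.mp x.2).1, ex_W (mem_Hf.mp z.2).1] at hxz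
      exact Subtype.ext hxz)
    rw [Fintype.linearIndependent_iff] at hl
    have h5 := hl _ h4
    rintro (P | h)
    · exact hP P
    · exact h5 h
  have := card_le_of_indep hq (yy_rel hY hS) (D + t) v hv hl
  rw [Fintype.card_sum, Fintype.card_coe, Fintype.card_coe] at this
  have := hg0 t
  omega

lemma stepanov_aux {q m : ℕ} (hcard : Fintype.card F = q) (hq : 2 ≤ q) {Y : ℕ → Ω} (hY : Rel q Y)
    (hLI : LI K q m Y) {g0 : ℕ} (hg0 : ∀ t, t + 1 ≤ (Hf q m t).card + g0)
    {S : Finset (ℕ → K)} (hS : ∀ P ∈ S, Rel q P)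
    (hd : ∀ P ∈ S, ∀ P' ∈ S, (∀ i ≤ m, P i = P' i) → P = P') (ν : ℕ) (hν : g0^2 + 3 * g0 + 1 < q^ν)
    (g : ℕ → F) (hg : ∀ P ∈ S, ∀ i ≤ m, P i ^ (q^(2*ν)) = tw g P i) :
    S.card ≤ q^(2*ν) + (3*g0+1) * q^ν := by
  classical
  set x := q^ν with hx
  have hx2 : q^(2*ν) = x * x := by rw [hx, two_mul, pow_add]
  set l := x - 1 with hl
  set m' := x + 2 * g0 with hm'
  set y := yy Y S with hy
  have hrel := yy_rel hY hS
  let v : Hf q m l × Hf q m m' → Ω × (S → K) :=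
    fun z => M q m y z.1.1 ^ x * mono m (tw g y) (ex q m z.2.1)
  have hv : ∀ z, v z ∈ Fil F q m y (x * l + m') := by
    rintro ⟨⟨a, ha⟩, ⟨b, hb⟩⟩
    rw [mem_Hf] at ha hb
    refine Fil_mul (Fil_mono (Nat.mul_le_mul_left _ ha.2) (Fil_pow (M_mem_Fil ha.1) x)) ?_
    refine Fil_mono ?_ (mono_tw_mem hrel.1 g _)
    rw [ex_W hb.1]; exact hb.2
  have hnl : ¬ LinearIndependent F v := by
    intro h
    have h1 := card_le_of_indep hq hrel _ v hv h
    rw [Fintype.card_prod, Fintype.card_coe, Fintype.card_coe] at h1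
    have h2 := hg0 l
    have h3 := hg0 m'
    have h4 : x - g0 ≤ (Hf q m l).card := by omega
    have h5 : x + g0 + 1 ≤ (Hf q m m').card := by omega
    have h6 := (Nat.mul_le_mul h4 h5).trans h1
    have h7 : g0 ≤ x := by nlinarith
    rw [hm', hl] at h6
    zify [h7, show 1 ≤ x by omega] at h6 hν
    nlinarith
  rw [Fintype.not_linearIndependent_iff] at hnl
  obtain ⟨c, hc, i0, hi0⟩ := hnl
  let Ψ : Ω × (S → K) := ∑ z : Hf q m l × Hf q m m', c z • (M q m y z.1.1 * M q m y z.2.1 ^ x)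
  have hΨ : Ψ ∈ Fil F q m y (l + x * m') := by
    refine Submodule.sum_mem _ fun z _ => Submodule.smul_mem _ _ ?_
    have ha := mem_Hf.mp z.1.2
    have hb := mem_Hf.mp z.2.2
    exact Fil_mul (Fil_mono ha.2 (M_mem_Fil ha.1))
      (Fil_mono (Nat.mul_le_mul_left _ hb.2) (Fil_pow (M_mem_Fil hb.1) x))
  have h1 : Ψ.1 ≠ 0 := by
    intro h
    have hMM : ∀ a b : ℕ, (M q m y a * M q m y b ^ x).1 = mono m Y (ex q m a + x • ex q m b) := by
      intro a b
      rw [mono_add]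
      simp only [Prod.fst_mul, Prod.pow_fst, M, hy, mono_fst]
      congr 1
      simp [mono, ← Finset.prod_pow, ← pow_mul, mul_comm]
    have hW : ∀ z : Hf q m l × Hf q m m', W q m (ex q m z.1.1 + x • ex q m z.2.1) = z.1.1 + x * z.2.1 := by
      intro z
      rw [W_add, ex_W (mem_Hf.mp z.1.2).1]
      congr 1
      conv_rhs => rw [← ex_W (mem_Hf.mp z.2.2).1]
      simp [W, Finset.mul_sum, mul_assoc]
    have hli := hLI (Hf q m l × Hf q m m') (fun z => ex q m z.1.1 + x • ex q m z.2.1) (by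
      intro z z' hz
      simp only [hW] at hz
      have b1 := (mem_Hf.mp z.1.2).2
      have b2 := (mem_Hf.mp z'.1.2).2
      have c1 : z.1.1 < x := by omega
      have c2 : z'.1.1 < x := by omega
      have e1 := congrArg (· % x) hz
      simp only [Nat.add_mul_mod_self_left, Nat.mod_eq_of_lt c1, Nat.mod_eq_of_lt c2] at e1
      rw [e1] at hz
      have e2 := Nat.eq_of_mul_eq_mul_left (by omega) (Nat.add_left_cancel hz)
      exact Prod.ext (Subtype.ext e1) (Subtype.ext e2))
    rw [Fintype.linearIndependent_iff] at hli
    have := hli (fun z => algebraMap F K (c z)) (by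
      rw [← h, Prod.fst_sum]
      refine Finset.sum_congr rfl fun z _ => ?_
      rw [Prod.smul_fst, hMM, algebraMap_smul]) i0
    exact hi0 (by simpa using this)
  have h2 : ∀ P, Ψ.2 P = 0 := by
    intro P
    obtain ⟨φ, hφ⟩ := exists_frob (F := F) (K := K) q hcard ν
    have hpow : φ (Ψ.2 P) = 0 := by
      have h3 := congrFun (congrArg Prod.snd hc) P
      rw [Prod.snd_sum, Finset.sum_apply] at h3
      rw [Prod.snd_sum, Finset.sum_apply, map_sum]
      rw [Prod.snd_zero, Pi.zero_apply] at h3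
      rw [← h3]
      refine Finset.sum_congr rfl fun z _ => ?_
      simp only [Prod.smul_snd, Pi.smul_apply, map_smul, v, Prod.snd_mul, Pi.mul_apply, Prod.pow_snd,
        Pi.pow_apply, hy, tw_snd, M, mono_snd, map_mul, map_pow]
      rw [hφ, hφ]
      congr 2
      rw [← pow_mul, ← hx2]
      simp only [mono, ← Finset.prod_pow]
      refine Finset.prod_congr rfl fun i hi => ?_
      rw [← hg P.1 P.2 (i+1) (by simp at hi; omega), ← pow_mul, ← pow_mul, mul_comm]
    rw [hφ] at hpow
    exact pow_eq_zero_iff (by omega) |>.mp hpow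
  have := zeros_le hq hY hLI hg0 hS hd (Fil_restrict hΨ) h1 h2
  rw [hx2]
  rw [hm', hl] at this
  have hxp : 1 ≤ x := by omega
  zify [hxp] at this ⊢
  nlinarith
end

universe u v

theorem stepanov {F : Type v} {K : Type u} [Field F] [Fintype F] [Field K] [Algebra F K] (q m : ℕ)
    (hcard : Fintype.card F = q) (hm : 1 ≤ m) :
    ∃ C N0 : ℕ, ∀ ν ≥ N0, ∀ (g : ℕ → F) (S : Finset (ℕ → K)), (∀ P ∈ S, Rel q P) →
      (∀ P ∈ S, ∀ P' ∈ S, (∀ i ≤ m, P i = P' i) → P = P') →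
      (∀ P ∈ S, ∀ i ≤ m, P i ^ (q^(2*ν)) = tw g P i) →
      S.card ≤ q^(2*ν) + C * q^ν := by
  have hq : 2 ≤ q := by rw [← hcard]; exact Fintype.one_lt_card
  obtain ⟨Ω, i1, i2, Y, hY, hLI⟩ := exists_omega K q hq
  let _ : Algebra F Ω := ((algebraMap K Ω).comp (algebraMap F K)).toAlgebra
  have _ : IsScalarTower F K Ω := IsScalarTower.of_algebraMap_eq fun x => rfl
  obtain ⟨g0, hg0⟩ := card_Hf_ge hq m hm
  refine ⟨3*g0+1, g0^2+3*g0+1, fun ν hν g S hS hd hg => ?_⟩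
  refine stepanov_aux hcard hq hY (fun ι a h => hLI m hm ι a h) hg0 hS hd ν ?_ g hg
  exact lt_of_le_of_lt hν (Nat.lt_pow_self (by omega))

end St

namespace St

/-- one-units modulo `X^(m+1)`, written additively -/
def GG (F : Type*) (m : ℕ) : Type _ := Fin m → F

section
variable {F : Type*} [Field F] {m : ℕ}

noncomputable def sig (a : GG F m) : PowerSeries F :=
  PowerSeries.mk fun i => if i = 0 then 1 else if h : i - 1 < m then a ⟨i-1, h⟩ else 0

noncomputable def tau (m : ℕ) (f : PowerSeries F) : GG F m := fun i => PowerSeries.coeff (i.1+1) f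

def EE (m : ℕ) (f g : PowerSeries F) : Prop := ∀ i ≤ m, PowerSeries.coeff i f = PowerSeries.coeff i g

lemma EE_mul {f f' g g' : PowerSeries F} (h1 : EE m f f') (h2 : EE m g g') : EE m (f * g) (f' * g') := by
  intro i hi
  rw [PowerSeries.coeff_mul, PowerSeries.coeff_mul]
  refine Finset.sum_congr rfl fun x hx => ?_
  have := Finset.HasAntidiagonal.mem_antidiagonal.mp hx
  rw [h1 x.1 (by omega), h2 x.2 (by omega)]

lemma EE.symm {f g : PowerSeries F} (h : EE m f g) : EE m g f := fun i hi => (h i hi).symm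
lemma EE.rfl' (f : PowerSeries F) : EE m f f := fun _ _ => rfl

lemma sig_const (a : GG F m) : PowerSeries.constantCoeff (sig a) = 1 := by
  simp [sig]
lemma sig_zero (a : GG F m) : PowerSeries.coeff 0 (sig a) = 1 := by
  simp [sig]

lemma tau_sig (a : GG F m) : tau m (sig a) = a := by
  funext i; simp [tau, sig]

lemma tau_eq_iff {f g : PowerSeries F} (hf : PowerSeries.coeff 0 f = 1) (hg : PowerSeries.coeff 0 g = 1) :
    tau m f = tau m g ↔ EE m f g := by
  constructor
  · intro h i hi
    rcases i with _ | i
    · rw [hf, hg]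
    · exact congrFun h ⟨i, by omega⟩
  · intro h; funext i; exact h _ (by omega)

lemma sig_tau {f : PowerSeries F} (hf : PowerSeries.coeff 0 f = 1) : EE m (sig (tau m f)) f :=
  (tau_eq_iff (sig_zero _) hf).mp (tau_sig _)

lemma coeff_zero_mul {f g : PowerSeries F} (hf : PowerSeries.coeff 0 f = 1)
    (hg : PowerSeries.coeff 0 g = 1) : PowerSeries.coeff 0 (f * g) = 1 := by
  simp only [PowerSeries.coeff_zero_eq_constantCoeff] at *
  rw [map_mul, hf, hg, one_mul]

noncomputable instance : Add (GG F m) := ⟨fun a b => tau m (sig a * sig b)⟩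
noncomputable instance : Zero (GG F m) := ⟨tau m 1⟩
noncomputable instance : Neg (GG F m) := ⟨fun a => tau m (sig a)⁻¹⟩

lemma tau_mul {f g : PowerSeries F} (hf : PowerSeries.coeff 0 f = 1)
    (hg : PowerSeries.coeff 0 g = 1) : tau m (f * g) = tau m f + tau m g := by
  change _ = tau m _
  rw [tau_eq_iff (coeff_zero_mul hf hg) (coeff_zero_mul (sig_zero _) (sig_zero _))]
  exact EE_mul (sig_tau hf).symm (sig_tau hg).symm

lemma coeff_zero_inv {f : PowerSeries F} (hf : PowerSeries.coeff 0 f = 1) :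
    PowerSeries.coeff 0 f⁻¹ = 1 := by
  simp only [PowerSeries.coeff_zero_eq_constantCoeff] at *
  rw [PowerSeries.constantCoeff_inv, hf, inv_one]

noncomputable instance : AddCommGroup (GG F m) where
  add_assoc a b c := by
    have h1 : a + b + c = tau m (sig a * sig b * sig c) := by
      rw [tau_mul (coeff_zero_mul (sig_zero _) (sig_zero _)) (sig_zero _),
        tau_mul (sig_zero _) (sig_zero _), tau_sig, tau_sig, tau_sig]
    have h2 : a + (b + c) = tau m (sig a * (sig b * sig c)) := by
      rw [tau_mul (sig_zero _) (coeff_zero_mul (sig_zero _) (sig_zero _)),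
        tau_mul (sig_zero _) (sig_zero _), tau_sig, tau_sig, tau_sig]
    rw [h1, h2, mul_assoc]
  zero_add a := by
    change tau m 1 + a = a
    conv_lhs => rw [← tau_sig a]
    rw [← tau_mul (by simp) (sig_zero _), one_mul, tau_sig]
  add_zero a := by
    change a + tau m 1 = a
    conv_lhs => rw [← tau_sig a]
    rw [← tau_mul (sig_zero _) (by simp), mul_one, tau_sig]
  nsmul := nsmulRec
  zsmul := zsmulRec
  neg_add_cancel a := by
    change tau m (sig a)⁻¹ + a = tau m 1
    have := tau_mul (m:=m) (coeff_zero_inv (sig_zero a)) (sig_zero a)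
    rw [tau_sig] at this
    rw [← this, PowerSeries.inv_mul_cancel _ (by rw [sig_const]; exact one_ne_zero)]
  add_comm a b := by
    change tau m _ = tau m _
    rw [mul_comm]

lemma tau_one : tau m (1 : PowerSeries F) = 0 := rfl

noncomputable instance [Fintype F] : Fintype (GG F m) := by
  classical exact inferInstanceAs (Fintype (Fin m → F))

lemma card_GG [Fintype F] : Fintype.card (GG F m) = Fintype.card F ^ m := by
  classical
  have : Fintype.card (GG F m) = Fintype.card (Fin m → F) := Fintype.card_congr (Equiv.refl _)
  rw [this]; simp

end

section
variable (F K : Type*) [Field F] [Fintype F] [Field K] [Algebra F K]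

noncomputable def Fr (n : ℕ) : K →ₐ[F] K := (exists_frob (F := F) (K := K) _ rfl n).choose

variable {F K}
lemma Fr_apply (n : ℕ) (x : K) : Fr F K n x = x ^ (Fintype.card F ^ n) :=
  (exists_frob (F := F) (K := K) _ rfl n).choose_spec x

lemma Fr_Fr (a b : ℕ) (x : K) : Fr F K a (Fr F K b x) = Fr F K (b+a) x := by
  rw [Fr_apply, Fr_apply, Fr_apply, ← pow_mul, ← pow_add]

noncomputable def up (f : PowerSeries F) : PowerSeries K := PowerSeries.map (algebraMap F K) f

lemma map_Fr_up (n : ℕ) (f : PowerSeries F) :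
    PowerSeries.map (Fr F K n : K →+* K) (up f) = up f := by
  ext i
  simp [up]

lemma exists_lift [IsAlgClosed K] (q : ℕ) (hq : 2 ≤ q) (x : K) :
    ∃ y : ℕ → K, y 0 = 1 ∧ ∀ i, y (i+1) ^ q = y (i+1) - x * y i := by
  have hex : ∀ c : K, ∃ z : K, z ^ q = z - c := by
    intro c
    have hd : (X ^ q - (X + C (-c)) : Polynomial K).degree ≠ 0 := by
      rw [Polynomial.degree_sub_eq_left_of_degree_lt]
      · rw [degree_X_pow]; norm_cast; omega
      · rw [degree_X_pow, degree_X_add_C]; norm_cast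
    obtain ⟨z, hz⟩ := IsAlgClosed.exists_root _ hd
    refine ⟨z, ?_⟩
    simp [IsRoot] at hz
    linear_combination hz
  choose rt hrt using hex
  exact ⟨fun n => Nat.rec 1 (fun _ z => rt (x * z)) n, rfl, fun i => hrt _⟩

noncomputable def lin (x : K) : PowerSeries K := 1 - PowerSeries.C x * PowerSeries.X

lemma coeff_lin_mul (x : K) (f : PowerSeries K) (i : ℕ) :
    PowerSeries.coeff (i+1) (lin x * f) = PowerSeries.coeff (i+1) f - x * PowerSeries.coeff i f := by
  unfold lin
  rw [sub_mul, one_mul, map_sub, mul_assoc, PowerSeries.coeff_C_mul, PowerSeries.coeff_succ_X_mul]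

lemma coeff_zero_lin (x : K) : PowerSeries.coeff 0 (lin x) = 1 := by
  simp [lin]

lemma map_lin (n : ℕ) (x : K) : PowerSeries.map (Fr F K n : K →+* K) (lin x) = lin (Fr F K n x) := by
  simp [lin]

lemma map_iter {y : PowerSeries K} {x : K} (h : PowerSeries.map (Fr F K 1 : K →+* K) y = lin x * y) (n : ℕ) :
    PowerSeries.map (Fr F K n : K →+* K) y = (∏ j ∈ Finset.range n, lin (Fr F K j x)) * y := by
  induction n with
  | zero => ext i; simp [Fr_apply]
  | succ n ih =>
    have e : PowerSeries.map (Fr F K (n+1) : K →+* K) y =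
        PowerSeries.map (Fr F K n : K →+* K) (PowerSeries.map (Fr F K 1 : K →+* K) y) := by
      ext i
      simp only [PowerSeries.coeff_map]
      change Fr F K (n+1) _ = Fr F K n (Fr F K 1 _)
      rw [Fr_Fr, add_comm]
    rw [e, h, map_mul, ih, map_lin, Finset.prod_range_succ]; ring

theorem fiber_bound [IsAlgClosed K] (q m : ℕ) (hcard : Fintype.card F = q) (hm : 1 ≤ m) :
    ∃ C N0 : ℕ, ∀ ν ≥ N0, ∀ (g : GG F m) (T : Finset K),
      (∀ x ∈ T, EE m (∏ j ∈ Finset.range (2*ν), lin (Fr F K j x)) (up (sig g))) →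
      q ^ m * T.card ≤ q^(2*ν) + C * q^ν := by
  classical
  have hq : 2 ≤ q := by rw [← hcard]; exact Fintype.one_lt_card
  obtain ⟨C, N0, h⟩ := stepanov (F := F) (K := K) q m hcard hm
  refine ⟨C, N0, fun ν hν g T hT => ?_⟩
  choose y hy0 hy1 using exists_lift (K := K) q hq
  let Y : K → PowerSeries K := fun x => PowerSeries.mk (y x)
  have hY0 : ∀ x, PowerSeries.coeff 0 (Y x) = 1 := fun x => by simp [Y, hy0]
  have hYl : ∀ x, PowerSeries.map (Fr F K 1 : K →+* K) (Y x) = lin x * Y x := by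
    intro x
    ext i
    rcases i with _ | i
    · rw [coeff_zero_mul (coeff_zero_lin x) (hY0 x), PowerSeries.coeff_map, hY0]; simp
    · rw [coeff_lin_mul, PowerSeries.coeff_map]
      change Fr F K 1 _ = _
      rw [Fr_apply, hcard, pow_one]
      simp [Y, hy1]
  let Q : K × GG F m → PowerSeries K := fun z => Y z.1 * up (sig z.2)
  have hup0 : ∀ a : GG F m, PowerSeries.coeff 0 (up (K := K) (sig a)) = 1 := by
    intro a
    rw [up, PowerSeries.coeff_map, sig_zero, map_one]
  have hQ0 : ∀ z, PowerSeries.coeff 0 (Q z) = 1 := fun z => coeff_zero_mul (hY0 _) (hup0 _)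
  have hQl : ∀ z, PowerSeries.map (Fr F K 1 : K →+* K) (Q z) = lin z.1 * Q z := by
    intro z
    simp only [Q]
    rw [map_mul, hYl, map_Fr_up, mul_assoc]
  have hQc : ∀ z i, PowerSeries.coeff (i+1) (Q z) ^ q =
      PowerSeries.coeff (i+1) (Q z) - z.1 * PowerSeries.coeff i (Q z) := by
    intro z i
    rw [← coeff_lin_mul, ← hQl, PowerSeries.coeff_map]
    change _ = Fr F K 1 _
    rw [Fr_apply, hcard, pow_one]
  have hinj : ∀ z z', EE m (Q z) (Q z') → z = z' := by
    intro z z' hzz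
    have hx : ∀ z, z.1 = PowerSeries.coeff 1 (Q z) - PowerSeries.coeff 1 (Q z) ^ q := by
      intro z
      rw [hQc z 0, hQ0]; ring
    have h1 : z.1 = z'.1 := by rw [hx z, hx z', hzz 1 hm]
    refine Prod.ext h1 ?_
    have h2 : EE m (up (K := K) (sig z.2)) (up (sig z'.2)) := by
      have hne : PowerSeries.constantCoeff (Y z.1) ≠ 0 := by
        rw [← PowerSeries.coeff_zero_eq_constantCoeff_apply, hY0]; exact one_ne_zero
      have e1 : up (sig z.2) = (Y z.1)⁻¹ * Q z := by
        simp only [Q]; rw [← mul_assoc, PowerSeries.inv_mul_cancel _ hne, one_mul]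
      have e2 : up (sig z'.2) = (Y z.1)⁻¹ * Q z' := by
        simp only [Q]; rw [← h1, ← mul_assoc, PowerSeries.inv_mul_cancel _ hne, one_mul]
      rw [e1, e2]
      exact EE_mul (EE.rfl' _) hzz
    rw [← tau_sig z.2, ← tau_sig z'.2, tau_eq_iff (sig_zero _) (sig_zero _)]
    intro i hi
    have := h2 i hi
    rw [up, up, PowerSeries.coeff_map, PowerSeries.coeff_map] at this
    exact (algebraMap F K).injective this
  let P : K × GG F m → (ℕ → K) := fun z i => PowerSeries.coeff i (Q z)
  have hPinj : Function.Injective P := fun z z' hz => hinj z z' fun i _ => congrFun hz i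
  have hS := h ν hν (fun i => PowerSeries.coeff i (sig g)) ((T ×ˢ Finset.univ).image P) ?_ ?_ ?_
  · rw [Finset.card_image_of_injective _ hPinj, Finset.card_product, Finset.card_univ, card_GG, hcard] at hS
    linarith [mul_comm (q^m) T.card]
  · intro p hp
    obtain ⟨z, hz, rfl⟩ := Finset.mem_image.mp hp
    refine ⟨hQ0 z, fun i => ?_⟩
    have e1 := hQc z 0
    have e2 := hQc z i
    rw [hQ0] at e1
    simp only [P]
    rw [e2, e1]; ring
  · intro p hp p' hp' hpp
    obtain ⟨z, hz, rfl⟩ := Finset.mem_image.mp hp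
    obtain ⟨z', hz', rfl⟩ := Finset.mem_image.mp hp'
    rw [hinj z z' hpp]
  · intro p hp i hi
    obtain ⟨z, hz, rfl⟩ := Finset.mem_image.mp hp
    have hzT : z.1 ∈ T := (Finset.mem_product.mp hz).1
    have e := map_iter (hQl z) (2*ν)
    have e1 := EE_mul (hT z.1 hzT) (EE.rfl' (m := m) (Q z)) i hi
    rw [← e, PowerSeries.coeff_map] at e1
    change Fr F K (2*ν) _ = _ at e1
    rw [Fr_apply, hcard] at e1
    simp only [P, tw]
    rw [e1, PowerSeries.coeff_mul i (up (sig g)) (Q z)]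
    refine Finset.sum_congr rfl fun x _ => ?_
    rw [up, PowerSeries.coeff_map]

end
end St

namespace St
section
variable {F : Type*} [Field F] [Fintype F] {m : ℕ}

noncomputable def cc (χ : AddChar (GG F m) ℂ) (d : ℕ) : ℂ := ∑ a : GG F d, χ (tau m (sig a))

lemma cc_zero (χ : AddChar (GG F m) ℂ) : cc χ 0 = 1 := by
  have hu : ∀ a : GG F 0, a = 0 := fun a => funext fun i => i.elim0
  have hs : sig (0 : GG F 0) = 1 := by
    ext i; simp [sig, PowerSeries.coeff_one]
  unfold cc
  rw [Finset.sum_eq_single (0 : GG F 0) (fun b _ hb => absurd (hu b) hb) (by simp), hs, tau_one]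
  simp

noncomputable def rho (d : ℕ) (h : m ≤ d) : GG F d →+ GG F m where
  toFun a := tau m (sig a)
  map_zero' := by
    rw [← tau_one (m := m), tau_eq_iff (sig_zero _) (by simp), ← tau_one]
    exact fun i hi => sig_tau (m := d) (by simp) i (by omega)
  map_add' a b := by
    rw [← tau_mul (sig_zero _) (sig_zero _),
      tau_eq_iff (sig_zero _) (coeff_zero_mul (sig_zero _) (sig_zero _))]
    exact fun i hi => sig_tau (m := d) (coeff_zero_mul (sig_zero _) (sig_zero _)) i (by omega)

lemma cc_big (χ : AddChar (GG F m) ℂ) (hχ : χ ≠ 0) (d : ℕ) (h : m ≤ d) : cc χ d = 0 := by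
  have : cc χ d = ∑ a, (χ.compAddMonoidHom (rho d h)) a := rfl
  rw [this, AddChar.sum_eq_zero_iff_ne_zero]
  obtain ⟨x, hx⟩ := AddChar.ne_zero_iff.mp hχ
  refine AddChar.ne_zero_iff.mpr ⟨tau d (sig x), ?_⟩
  rw [AddChar.compAddMonoidHom_apply]
  have : rho d h (tau d (sig x)) = x := by
    change tau m (sig (tau d (sig x))) = x
    conv_rhs => rw [← tau_sig x]
    rw [tau_eq_iff (sig_zero _) (sig_zero _)]
    exact fun i hi => sig_tau (m := d) (sig_zero _) i (by omega)
  rw [this]; exact hx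

/-- class of a monic polynomial -/
noncomputable def th (m : ℕ) (H : Polynomial F) : GG F m := tau m (H.reverse : PowerSeries F)

lemma rev0 {H : Polynomial F} (h : H.Monic) : PowerSeries.coeff 0 (H.reverse : PowerSeries F) = 1 := by
  rw [Polynomial.coeff_coe, coeff_zero_reverse, h.leadingCoeff]

lemma th_mul {H G : Polynomial F} (h : H.Monic) (g : G.Monic) : th m (H * G) = th m H + th m G := by
  unfold th
  rw [reverse_mul_of_domain, Polynomial.coe_mul, tau_mul (rev0 h) (rev0 g)]

variable (F) in
noncomputable def monE (d : ℕ) : (Fin d → F) ≃ {P : Polynomial F // P.Monic ∧ P.natDegree = d} :=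
  ((monicEquivDegreeLT d).trans (degreeLTEquiv F d).toEquiv).symm

variable (F) in
noncomputable def mon (d : ℕ) : Finset (Polynomial F) := by
  classical exact Finset.univ.map ((monE F d).toEmbedding.trans (Function.Embedding.subtype _))

lemma mem_mon {d : ℕ} {P : Polynomial F} : P ∈ mon F d ↔ P.Monic ∧ P.natDegree = d := by
  classical
  unfold mon
  rw [Finset.mem_map]
  constructor
  · rintro ⟨a, -, rfl⟩
    exact (monE F d a).2
  · intro h
    exact ⟨(monE F d).symm ⟨P, h⟩, Finset.mem_univ _, by simp⟩

lemma card_mon (d : ℕ) : (mon F d).card = Fintype.card F ^ d := by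
  classical
  simp [mon]

lemma sig_rev {d : ℕ} {P : Polynomial F} (hP : P.Monic) (hd : P.natDegree = d) :
    sig (th d P) = (P.reverse : PowerSeries F) := by
  ext i
  by_cases hi : i ≤ d
  · exact sig_tau (rev0 hP) i hi
  · rw [Polynomial.coeff_coe, coeff_eq_zero_of_natDegree_lt
      (lt_of_le_of_lt (reverse_natDegree_le P) (by omega))]
    simp only [sig, PowerSeries.coeff_mk]
    rw [if_neg (by omega), dif_neg (by omega)]

lemma cc_mon (χ : AddChar (GG F m) ℂ) (d : ℕ) : cc χ d = ∑ P ∈ mon F d, χ (th m P) := by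
  classical
  have hinj : Set.InjOn (th (F := F) d) (mon F d) := by
    intro P hP Q hQ h
    obtain ⟨p1, p2⟩ := mem_mon.mp hP
    obtain ⟨q1, q2⟩ := mem_mon.mp hQ
    have e : P.reverse = Q.reverse := by
      apply Polynomial.coe_injective
      rw [← sig_rev p1 p2, ← sig_rev q1 q2, h]
    ext i
    have := congrArg (fun R => R.coeff (revAt d i)) e
    simp only [coeff_reverse, p2, q2, revAt_invol] at this
    exact this
  have him : (mon F d).image (th d) = Finset.univ := by
    rw [← Finset.card_eq_iff_eq_univ, Finset.card_image_of_injOn hinj, card_mon, card_GG]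
  unfold cc
  rw [← him, Finset.sum_image hinj]
  refine Finset.sum_congr rfl fun P hP => ?_
  obtain ⟨p1, p2⟩ := mem_mon.mp hP
  rw [sig_rev p1 p2, th]

end
end St

namespace St
section
variable {F K : Type*} [Field F] [Fintype F] [Field K] [Algebra F K] 

lemma Fr_zero (x : K) : Fr F K 0 x = x := by rw [Fr_apply]; simp

lemma mem_range_of_Fr (y : K) (h : Fr F K 1 y = y) : y ∈ Set.range (algebraMap F K) := by
  classical
  have hd := FiniteField.X_pow_card_sub_X_natDegree_eq K (Fintype.one_lt_card (α := F))
  have h0 := FiniteField.X_pow_card_sub_X_ne_zero K (Fintype.one_lt_card (α := F))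
  by_contra hy
  have hsub : insert y (Finset.univ.image (algebraMap F K)) ⊆
      (X ^ Fintype.card F - X : Polynomial K).roots.toFinset := by
    intro z hz
    rw [Multiset.mem_toFinset, mem_roots h0]
    rcases Finset.mem_insert.mp hz with rfl | hz
    · rw [Fr_apply, pow_one] at h
      simp [IsRoot, h]
    · obtain ⟨a, -, rfl⟩ := Finset.mem_image.mp hz
      simp [IsRoot, ← map_pow, FiniteField.pow_card]
  have h1 := Finset.card_le_card hsub
  rw [Finset.card_insert_of_notMem (by simpa using hy),
    Finset.card_image_of_injective _ (algebraMap F K).injective, Finset.card_univ] at h1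
  have h2 := (Multiset.toFinset_card_le (X ^ Fintype.card F - X : Polynomial K).roots)
  have h3 := card_roots' (X ^ Fintype.card F - X : Polynomial K)
  omega

variable (F) in
noncomputable def PK (n : ℕ) (x : K) : Polynomial K := ∏ i ∈ Finset.range n, (X - C (Fr F K i x))

lemma PK_monic (n : ℕ) (x : K) : (PK F n x).Monic := monic_prod_of_monic _ _ fun _ _ => monic_X_sub_C _
lemma PK_deg (n : ℕ) (x : K) : (PK F n x).natDegree = n := by
  unfold PK
  rw [natDegree_prod_of_monic _ _ fun _ _ => monic_X_sub_C _]
  simp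

lemma PK_map (n : ℕ) (x : K) (h : Fr F K n x = x) :
    (PK F n x).map (Fr F K 1 : K →+* K) = PK F n x := by
  have e : (PK F n x).map (Fr F K 1 : K →+* K) = ∏ i ∈ Finset.range n, (X - C (Fr F K (i+1) x)) := by
    unfold PK
    rw [Polynomial.map_prod]
    refine Finset.prod_congr rfl fun i _ => ?_
    simp [Fr_Fr]
  have h1 := Finset.prod_range_succ (fun i => (X - C (Fr F K i x))) n
  have h2 := Finset.prod_range_succ' (fun i => (X - C (Fr F K i x))) n
  rw [h1, h, Fr_zero] at h2
  have h3 := mul_right_cancel₀ (X_sub_C_ne_zero x) h2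
  rw [e, ← h3, PK]

lemma exists_desc (n : ℕ) (x : K) (h : Fr F K n x = x) :
    ∃ P : Polynomial F, P.map (algebraMap F K) = PK F n x ∧ P.natDegree = n ∧ P.Monic := by
  have hl : PK F n x ∈ lifts (algebraMap F K) := by
    rw [lifts_iff_coeff_lifts]
    intro i
    apply mem_range_of_Fr
    have := congrArg (fun Q => Q.coeff i) (PK_map n x h)
    simpa using this
  obtain ⟨P, h1, h2, h3⟩ := lifts_and_natDegree_eq_and_monic hl (PK_monic n x)
  exact ⟨P, h1, by rw [h2, PK_deg], h3⟩

open Classical in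
variable (F) in
noncomputable def PF (n : ℕ) (x : K) : Polynomial F :=
  if h : Fr F K n x = x then (exists_desc n x h).choose else 1

lemma PF_spec {n : ℕ} {x : K} (h : Fr F K n x = x) :
    (PF F n x).map (algebraMap F K) = PK F n x ∧ (PF F n x).natDegree = n ∧ (PF F n x).Monic := by
  unfold PF
  rw [dif_pos h]
  exact (exists_desc n x h).choose_spec

lemma rev_lin (x : K) : ((X - C x : Polynomial K).reverse : PowerSeries K) = lin x := by
  have : (X - C x : Polynomial K).reverse = 1 - C x * X := by
    rw [reverse, natDegree_X_sub_C, reflect_sub, reflect_C]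
    simp [Polynomial.reflect_one_X]
  rw [this]
  simp [lin]

lemma rev_PK (n : ℕ) (x : K) :
    ((PK F n x).reverse : PowerSeries K) = ∏ j ∈ Finset.range n, lin (Fr F K j x) := by
  unfold PK
  induction n with
  | zero => 
    simp only [Finset.range_zero, Finset.prod_empty]
    rw [← C_1, reverse_C]; simp
  | succ n ih =>
    rw [Finset.prod_range_succ, Finset.prod_range_succ, reverse_mul_of_domain, Polynomial.coe_mul, ih, rev_lin]

lemma up_rev_PF {n : ℕ} {x : K} (h : Fr F K n x = x) :
    up ((PF F n x).reverse : PowerSeries F) = ∏ j ∈ Finset.range n, lin (Fr F K j x) := by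
  obtain ⟨h1, h2, h3⟩ := PF_spec h
  rw [← rev_PK, ← h1]
  ext i
  rw [up, PowerSeries.coeff_map, coeff_coe, coeff_coe, coeff_reverse, coeff_reverse, natDegree_map, coeff_map]

variable (F K) in
noncomputable def Fx (n : ℕ) : Finset K := by
  classical exact (X ^ (Fintype.card F ^ n) - X : Polynomial K).roots.toFinset

lemma mem_Fx {n : ℕ} (hn : n ≠ 0) {x : K} : x ∈ Fx F K n ↔ Fr F K n x = x := by
  classical
  unfold Fx
  have h0 := FiniteField.X_pow_card_sub_X_ne_zero K (Nat.one_lt_pow hn (Fintype.one_lt_card (α := F)))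
  rw [Multiset.mem_toFinset, mem_roots h0, Fr_apply]
  simp [IsRoot, sub_eq_zero]

lemma card_Fx [IsAlgClosed K] {n : ℕ} (hn : n ≠ 0) : (Fx F K n).card = Fintype.card F ^ n := by
  classical
  obtain ⟨p, hp⟩ := CharP.exists F
  have : CharP K p := (Algebra.charP_iff F K p).mp hp
  have hpc : p ∣ Fintype.card F ^ n := by
    obtain ⟨k, hp, hk⟩ := FiniteField.card F p
    rw [hk, ← pow_mul]
    exact dvd_pow_self _ (Nat.mul_ne_zero k.ne_zero hn)
  have hs := galois_poly_separable (K := K) p (Fintype.card F ^ n) hpc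
  have hd := FiniteField.X_pow_card_sub_X_natDegree_eq K (Nat.one_lt_pow hn (Fintype.one_lt_card (α := F)))
  unfold Fx
  rw [Multiset.toFinset_card_of_nodup (nodup_roots hs)]
  exact (splits_iff_card_roots.mp (IsAlgClosed.splits (X ^ (Fintype.card F ^ n) - X : Polynomial K))).trans hd

lemma Fr_iter (n : ℕ) (x : K) : (Fr F K 1)^[n] x = Fr F K n x := by
  induction n with
  | zero => simp [Fr_zero]
  | succ n ih => rw [Function.iterate_succ_apply', ih, Fr_Fr]

lemma Fr_inj (n : ℕ) : Function.Injective (Fr F K n) := (Fr F K n).toRingHom.injective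

lemma PK_period {e : ℕ} {x : K} (h : Fr F K e x = x) (j : ℕ) : PK F (e * j) x = PK F e x ^ j := by
  induction j with
  | zero => simp [PK]
  | succ j ih =>
    have hj : ∀ i j, Fr F K (e * j + i) x = Fr F K i x := by
      intro i j
      induction j with
      | zero => simp
      | succ j ih => 
        have : e * (j+1) + i = e + (e * j + i) := by ring
        rw [this, ← Fr_Fr, h, ih]
    rw [pow_succ, ← ih, Nat.mul_succ]
    unfold PK
    rw [Finset.prod_range_add]
    congr 1
    refine Finset.prod_congr rfl fun i _ => ?_
    rw [hj]

lemma count_x (H : Polynomial F) (hH : H.Monic) (x : K) (d : ℕ) (hd : H.natDegree = d) 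
    [DecidableEq K] [DecidablePred fun n => Fr F K n x = x ∧ PF F n x ∣ H] :
    ((Finset.Icc 1 d).filter fun n => Fr F K n x = x ∧ PF F n x ∣ H).card =
      (H.map (algebraMap F K)).roots.count x := by
  set HK := H.map (algebraMap F K) with hHK
  have hKm : HK.Monic := hH.map _
  have hdv : ∀ n, Fr F K n x = x → (PF F n x ∣ H ↔ PK F n x ∣ HK) := by
    intro n hn
    rw [← (PF_spec hn).1, hHK, map_dvd_map']
  have hroot : ∀ n, 1 ≤ n → PK F n x ∣ HK → HK.IsRoot x := by
    intro n hn hdvd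
    rw [← dvd_iff_isRoot]
    refine dvd_trans ?_ hdvd
    have := Finset.dvd_prod_of_mem (fun i => (X - C (Fr F K i x))) (Finset.mem_range.mpr (show 0 < n by omega))
    rwa [Fr_zero] at this
  have hHmap : ∀ i, HK.map (Fr F K i : K →+* K) = HK := by
    intro i
    rw [hHK, Polynomial.map_map]
    congr 1
    ext a; simp
  by_cases hx : HK.IsRoot x
  swap
  · rw [Multiset.count_eq_zero_of_notMem (fun h => hx (isRoot_of_mem_roots h)), Finset.card_eq_zero,
      Finset.filter_eq_empty_iff]
    rintro n hn ⟨h1, h2⟩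
    exact hx (hroot n (Finset.mem_Icc.mp hn).1 ((hdv n h1).mp h2))
  have hper : x ∈ Function.periodicPts (Fr F K 1) := by
    have : ∀ i : ℕ, Fr F K i x ∈ HK.roots.toFinset := by
      intro i
      rw [Multiset.mem_toFinset, mem_roots hKm.ne_zero]
      have := hx.map (f := (Fr F K i : K →+* K))
      rw [hHmap] at this
      exact this
    obtain ⟨a, b, hab, h⟩ := Finite.exists_ne_map_eq_of_infinite
      (fun i : ℕ => (⟨Fr F K i x, this i⟩ : {z // z ∈ HK.roots.toFinset}))
    have h : Fr F K a x = Fr F K b x := congrArg Subtype.val h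
    have key : ∀ a b : ℕ, a < b → Fr F K a x = Fr F K b x → x ∈ Function.periodicPts (Fr F K 1) := by
      intro a b hab h
      refine Function.mem_periodicPts.mpr ⟨b - a, by omega, ?_⟩
      change _ = _
      rw [Fr_iter]
      apply Fr_inj (F := F) a
      rw [Fr_Fr, h]; congr 2; omega
    rcases lt_or_gt_of_ne hab with h' | h'
    · exact key a b h' h
    · exact key b a h' h.symm
  set e := Function.minimalPeriod (Fr F K 1) x with he
  have he0 : 0 < e := Function.minimalPeriod_pos_of_mem_periodicPts hper
  have hedvd : ∀ n, Fr F K n x = x ↔ e ∣ n := by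
    intro n
    rw [he, ← Function.isPeriodicPt_iff_minimalPeriod_dvd]
    change _ ↔ _ = _
    rw [Fr_iter]
  have hex : Fr F K e x = x := (hedvd e).mpr dvd_rfl
  have hmult : ∀ j, 1 ≤ j → (PK F (e * j) x ∣ HK ↔ j ≤ HK.rootMultiplicity x) := by
    intro j hj
    rw [le_rootMultiplicity_iff hKm.ne_zero, PK_period hex]
    constructor
    · intro h
      refine dvd_trans (pow_dvd_pow_of_dvd ?_ j) h
      have := Finset.dvd_prod_of_mem (fun i => (X - C (Fr F K i x))) (Finset.mem_range.mpr he0)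
      rwa [Fr_zero] at this
    · intro h
      unfold PK
      rw [← Finset.prod_pow]
      refine Finset.prod_dvd_of_coprime ?_ ?_
      · intro a ha b hb hab
        refine IsCoprime.pow ?_
        refine isCoprime_X_sub_C_of_isUnit_sub ?_
        rw [isUnit_iff_ne_zero, sub_ne_zero]
        intro h
        rw [← Fr_iter, ← Fr_iter] at h
        have := Function.iterate_injOn_Iio_minimalPeriod (f := Fr F K 1) (x := x)
          (by simpa using ha) (by simpa using hb) h
        exact hab this
      · intro i _
        have := Polynomial.map_dvd (Fr F K i : K →+* K) h
        rw [hHmap] at this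
        simpa using this
  rw [count_roots]
  have himg : ((Finset.Icc 1 d).filter fun n => Fr F K n x = x ∧ PF F n x ∣ H) =
      (Finset.Icc 1 (HK.rootMultiplicity x)).image (e * ·) := by
    ext n
    rw [Finset.mem_filter, Finset.mem_image, Finset.mem_Icc]
    constructor
    · rintro ⟨⟨h1, h2⟩, h3, h4⟩
      obtain ⟨j, rfl⟩ := (hedvd n).mp h3
      have hj : 1 ≤ j := Nat.pos_of_ne_zero (by rintro rfl; simp at h1)
      exact ⟨j, Finset.mem_Icc.mpr ⟨hj, (hmult j hj).mp ((hdv _ h3).mp h4)⟩, rfl⟩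
    · rintro ⟨j, hj, rfl⟩
      rw [Finset.mem_Icc] at hj
      have h3 := (hedvd (e * j)).mpr (Dvd.intro _ rfl)
      have h4 := (hmult j hj.1).mpr hj.2
      refine ⟨⟨Nat.mul_pos he0 hj.1, ?_⟩, h3, (hdv _ h3).mpr h4⟩
      have := natDegree_le_of_dvd h4 hKm.ne_zero
      rw [PK_deg, hHK, natDegree_map, hd] at this
      exact this
  rw [himg, Finset.card_image_of_injective _ (fun a b h => Nat.eq_of_mul_eq_mul_left he0 h)]
  simp

end
end St

namespace St
section
variable {F K : Type*} [Field F] [Fintype F] [Field K] [Algebra F K] [IsAlgClosed K] {m : ℕ}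

open Classical in
lemma count_tot (H : Polynomial F) (hH : H.Monic) (d : ℕ) (hd : H.natDegree = d) :
    ∑ n ∈ Finset.Icc 1 d, ((Fx F K n).filter fun x => PF F n x ∣ H).card = d := by
  set R := (H.map (algebraMap F K)).roots with hR
  have h1 : ∀ n ∈ Finset.Icc 1 d, ((Fx F K n).filter fun x => PF F n x ∣ H).card =
      ∑ x ∈ R.toFinset, if Fr F K n x = x ∧ PF F n x ∣ H then 1 else 0 := by
    intro n hn
    have hn' := Finset.mem_Icc.mp hn
    rw [Finset.sum_boole, Nat.cast_id]
    congr 1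
    ext x
    rw [Finset.mem_filter, Finset.mem_filter, mem_Fx (by omega), Multiset.mem_toFinset]
    constructor
    · rintro ⟨h1, h2⟩
      refine ⟨?_, h1, h2⟩
      rw [← Multiset.count_pos, ← count_x H hH x d hd, Finset.card_pos]
      exact ⟨n, Finset.mem_filter.mpr ⟨hn, h1, h2⟩⟩
    · rintro ⟨_, h⟩; exact h
  rw [Finset.sum_congr rfl h1, Finset.sum_comm]
  have h2 : ∀ x ∈ R.toFinset, (∑ n ∈ Finset.Icc 1 d, if Fr F K n x = x ∧ PF F n x ∣ H then 1 else 0) =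
      R.count x := by
    intro x _
    rw [Finset.sum_boole, Nat.cast_id, ← count_x H hH x d hd]
  rw [Finset.sum_congr rfl h2, Multiset.toFinset_sum_count_eq, hR,
    splits_iff_card_roots.mp (IsAlgClosed.splits _), natDegree_map, hd]

variable (K) in
noncomputable def SS (χ : AddChar (GG F m) ℂ) (n : ℕ) : ℂ := ∑ x ∈ Fx F K n, χ (th m (PF F n x))

theorem main_id (χ : AddChar (GG F m) ℂ) (d : ℕ) :
    (d : ℂ) * cc χ d = ∑ n ∈ Finset.Icc 1 d, SS K χ n * cc χ (d - n) := by
  classical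
  have h1 : ∀ n ∈ Finset.Icc 1 d, ∀ x ∈ Fx F K n, χ (th m (PF F n x)) * cc χ (d - n) =
      ∑ H ∈ mon F d, if PF F n x ∣ H then χ (th m H) else 0 := by
    intro n hn x hx
    have hn' := Finset.mem_Icc.mp hn
    rw [mem_Fx (by omega)] at hx
    obtain ⟨-, hdeg, hmon⟩ := PF_spec hx
    rw [cc_mon, Finset.mul_sum, ← Finset.sum_filter]
    refine Finset.sum_bij (fun Q _ => PF F n x * Q) ?_ ?_ ?_ ?_
    · intro Q hQ
      obtain ⟨q1, q2⟩ := mem_mon.mp hQ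
      rw [Finset.mem_filter, mem_mon]
      refine ⟨⟨hmon.mul q1, ?_⟩, dvd_mul_right _ _⟩
      rw [hmon.natDegree_mul q1, hdeg, q2]; omega
    · intro Q _ Q' _ h
      exact mul_left_cancel₀ hmon.ne_zero h
    · intro H hH
      rw [Finset.mem_filter, mem_mon] at hH
      obtain ⟨⟨h1, h2⟩, Q, rfl⟩ := hH
      have hQ : Q.Monic := hmon.of_mul_monic_left h1
      refine ⟨Q, mem_mon.mpr ⟨hQ, ?_⟩, rfl⟩
      rw [hmon.natDegree_mul hQ, hdeg] at h2; omega
    · intro Q hQ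
      obtain ⟨q1, q2⟩ := mem_mon.mp hQ
      rw [th_mul hmon q1, AddChar.map_add_eq_mul]
  unfold SS
  have h2 : ∀ n ∈ Finset.Icc 1 d, (∑ x ∈ Fx F K n, χ (th m (PF F n x))) * cc χ (d - n) =
      ∑ H ∈ mon F d, (((Fx F K n).filter fun x => PF F n x ∣ H).card : ℂ) * χ (th m H) := by
    intro n hn
    rw [Finset.sum_mul, Finset.sum_congr rfl (h1 n hn), Finset.sum_comm]
    refine Finset.sum_congr rfl fun H _ => ?_
    rw [← Finset.sum_filter, Finset.sum_const, nsmul_eq_mul]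
  rw [Finset.sum_congr rfl h2, Finset.sum_comm, cc_mon, Finset.mul_sum]
  refine Finset.sum_congr rfl fun H hH => ?_
  obtain ⟨q1, q2⟩ := mem_mon.mp hH
  rw [← Finset.sum_mul, ← Nat.cast_sum, count_tot H q1 d q2]

lemma norm_chi (χ : AddChar (GG F m) ℂ) (a : GG F m) : ‖χ a‖ = 1 := by
  have h : χ a ^ (Fintype.card (GG F m)) = 1 := by
    rw [← AddChar.map_nsmul_eq_pow, card_nsmul_eq_zero, AddChar.map_zero_eq_one]
  exact Complex.norm_eq_one_of_pow_eq_one h Fintype.card_ne_zero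

theorem SS_bound (hm : 1 ≤ m) : ∃ (C : ℝ) (N0 : ℕ), ∀ χ : AddChar (GG F m) ℂ, χ ≠ 0 → 
    ∀ ν ≥ N0, ‖SS K χ (2*ν)‖ ≤ C * (Fintype.card F : ℝ) ^ ν := by
  classical
  obtain ⟨C, N0, h⟩ := fiber_bound (F := F) (K := K) (Fintype.card F) m rfl hm
  set q := Fintype.card F with hq
  have hq0 : (0:ℝ) < q := by exact_mod_cast Fintype.card_pos
  refine ⟨2 * C, N0 + 1, fun χ hχ ν hν => ?_⟩
  let M : GG F m → Finset K := fun g => (Fx F K (2*ν)).filter fun x => th m (PF F (2*ν) x) = g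
  have hM : ∀ g, q ^ m * (M g).card ≤ q ^ (2*ν) + C * q ^ ν := by
    intro g
    apply h ν (by omega) g
    intro x hx
    rw [Finset.mem_filter, mem_Fx (by omega)] at hx
    obtain ⟨hx1, hx2⟩ := hx
    rw [← up_rev_PF hx1]
    have := sig_tau (m := m) (rev0 (PF_spec hx1).2.2)
    rw [← th, hx2] at this
    intro i hi
    rw [up, up, PowerSeries.coeff_map, PowerSeries.coeff_map, this i hi]
  have hsum : ∑ g, (M g).card = q ^ (2*ν) := by
    rw [← card_Fx (K := K) (n := 2*ν) (by omega)]
    exact (Finset.card_eq_sum_card_fiberwise (fun x _ => Finset.mem_univ _)).symm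
  have hS : SS K χ (2*ν) = ∑ g, ((M g).card : ℂ) * χ g := by
    unfold SS
    rw [← Finset.sum_fiberwise (s := Fx F K (2*ν)) (g := fun x => th m (PF F (2*ν) x))]
    refine Finset.sum_congr rfl fun g _ => ?_
    rw [Finset.sum_congr rfl (g := fun _ => χ g) fun x hx => by rw [(Finset.mem_filter.mp hx).2],
      Finset.sum_const, nsmul_eq_mul]
  let ε : GG F m → ℝ := fun g => (q:ℝ)^m * (M g).card - (q:ℝ)^(2*ν)
  have hε : ∀ g, ε g ≤ C * (q:ℝ)^ν := by
    intro g
    have : ((q ^ m * (M g).card : ℕ) : ℝ) ≤ ((q ^ (2*ν) + C * q ^ ν : ℕ):ℝ) := by exact_mod_cast hM g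
    push_cast at this
    simp only [ε]; linarith
  have hcG : ((Finset.univ : Finset (GG F m)).card : ℝ) = (q:ℝ)^m := by
    rw [Finset.card_univ, card_GG]; push_cast; rfl
  have hε0 : ∑ g, ε g = 0 := by
    simp only [ε]
    rw [Finset.sum_sub_distrib, ← Finset.mul_sum, ← Nat.cast_sum, hsum, Finset.sum_const, nsmul_eq_mul, hcG]
    push_cast; ring
  have habs : ∑ g, |ε g| ≤ (q:ℝ)^m * (2 * C * (q:ℝ)^ν) := by
    have : ∀ g, |ε g| ≤ 2 * (C * (q:ℝ)^ν) - ε g := by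
      intro g
      have h0 : 0 ≤ C * (q:ℝ)^ν := by positivity
      rw [abs_le]; constructor <;> linarith [hε g]
    refine (Finset.sum_le_sum fun g _ => this g).trans ?_
    rw [Finset.sum_sub_distrib, hε0, Finset.sum_const, nsmul_eq_mul, hcG]
    linarith
  have hfin : (q:ℂ)^m * SS K χ (2*ν) = ∑ g, (ε g : ℂ) * χ g := by
    simp only [ε]
    push_cast
    simp only [sub_mul]
    rw [Finset.sum_sub_distrib, ← Finset.mul_sum, AddChar.sum_eq_zero_iff_ne_zero.mpr hχ, mul_zero,
      sub_zero, hS, Finset.mul_sum]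
    simp only [mul_assoc]
  have hn : (q:ℝ)^m * ‖SS K χ (2*ν)‖ ≤ (q:ℝ)^m * (2 * C * (q:ℝ)^ν) := by
    have e : ‖(q:ℂ)^m * SS K χ (2*ν)‖ = (q:ℝ)^m * ‖SS K χ (2*ν)‖ := by
      rw [norm_mul, norm_pow, Complex.norm_natCast]
    rw [← e, hfin]
    refine (norm_sum_le _ _).trans (le_trans (Finset.sum_le_sum fun g _ => ?_) habs)
    rw [norm_mul, norm_chi, mul_one, Complex.norm_real, Real.norm_eq_abs]
  exact le_of_mul_le_mul_left hn (by positivity)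

end
end St

namespace St

lemma root_bound_aux (q : ℝ) (hq : 0 < q) (B : Finset ℂ) : ∀ (w : ℂ → ℂ) (C : ℝ) (N0 : ℕ),
    (∀ n ≥ N0, ‖∑ b ∈ B, w b * b ^ n‖ ≤ C * q ^ n) → ∀ b ∈ B, w b ≠ 0 → ‖b‖ ≤ q := by
  classical
  induction B using Finset.induction with
  | empty => simp
  | insert b0 B hb0 ih =>
    intro w C N0 h
    have hB : ∀ b ∈ B, w b ≠ 0 → ‖b‖ ≤ q := by
      intro b hb hw
      refine ih (fun b => w b * (b - b0)) (C * (q + ‖b0‖)) N0 ?_ b hb ?_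
      · intro n hn
        have e : ∑ b ∈ B, w b * (b - b0) * b ^ n =
            ∑ b ∈ insert b0 B, w b * b ^ (n+1) - b0 * ∑ b ∈ insert b0 B, w b * b ^ n := by
          rw [Finset.mul_sum, ← Finset.sum_sub_distrib, Finset.sum_insert hb0]
          have : w b0 * b0 ^ (n+1) - b0 * (w b0 * b0 ^ n) = 0 := by ring
          rw [this, zero_add]
          exact Finset.sum_congr rfl fun b _ => by ring
        rw [e]
        refine (norm_sub_le _ _).trans ?_
        rw [norm_mul]
        have h1 := h (n+1) (by omega)
        have h2 := mul_le_mul_of_nonneg_left (h n hn) (norm_nonneg b0)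
        calc _ ≤ C * q ^ (n+1) + ‖b0‖ * (C * q^n) := add_le_add h1 h2
          _ = _ := by ring
      · refine mul_ne_zero hw (sub_ne_zero.mpr ?_)
        rintro rfl; exact hb0 hb
    intro b hb hw
    rcases Finset.mem_insert.mp hb with rfl | hb
    swap
    · exact hB b hb hw
    by_contra hlt
    push Not at hlt
    have hbd : ∀ n ≥ N0, ‖w b‖ * ‖b‖ ^ n ≤ (C + ∑ b ∈ B, ‖w b‖) * q ^ n := by
      intro n hn
      have e : w b * b ^ n = ∑ b ∈ insert b B, w b * b ^ n - ∑ b ∈ B, w b * b ^ n := by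
        rw [Finset.sum_insert hb0]; ring
      rw [← norm_pow, ← norm_mul, e, add_mul]
      refine (norm_sub_le _ _).trans (add_le_add (h n hn) ?_)
      rw [Finset.sum_mul]
      refine (norm_sum_le _ _).trans (Finset.sum_le_sum fun a ha => ?_)
      rw [norm_mul, norm_pow]
      by_cases hw : w a = 0
      · simp [hw]
      · have := hB a ha hw
        gcongr
    set D := C + ∑ b ∈ B, ‖w b‖
    have hw0 : 0 < ‖w b‖ := norm_pos_iff.mpr hw
    have hr : 1 < ‖b‖ / q := (one_lt_div hq).mpr hlt
    obtain ⟨n, hn⟩ := pow_unbounded_of_one_lt (D / ‖w b‖) hr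
    have h1 : D / ‖w b‖ < (‖b‖/q) ^ (n + N0) :=
      hn.trans_le (pow_le_pow_right₀ hr.le (by omega))
    have h2 := hbd (n + N0) (by omega)
    rw [div_pow, div_lt_div_iff₀ hw0 (by positivity)] at h1
    linarith [mul_comm ‖w b‖ (‖b‖ ^ (n + N0))]

lemma root_bound {N : ℕ} (q : ℝ) (hq : 0 < q) (α : Fin N → ℂ) (C : ℝ) (N0 : ℕ)
    (h : ∀ n ≥ N0, ‖∑ i, α i ^ (2 * n)‖ ≤ C * q ^ n) (i : Fin N) : ‖α i‖ ≤ √q := by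
  classical
  have := root_bound_aux q hq (Finset.univ.image fun i => α i ^ 2)
    (fun b => ((Finset.univ.filter fun i => α i ^ 2 = b).card : ℂ)) C N0 ?_ (α i ^ 2)
    (Finset.mem_image_of_mem _ (Finset.mem_univ _)) ?_
  · apply Real.le_sqrt_of_sq_le
    rwa [norm_pow] at this
  · intro n hn
    convert h n hn using 2
    rw [Finset.sum_image']
    intro i _
    rw [Finset.sum_congr rfl (g := fun _ => (α i ^ 2) ^ n) (fun j hj => by
      rw [pow_mul, (Finset.mem_filter.mp hj).2]), Finset.sum_const, nsmul_eq_mul]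
  · simp only [ne_eq, Nat.cast_eq_zero, Finset.card_eq_zero, Finset.filter_eq_empty_iff]
    push Not
    exact ⟨i, Finset.mem_univ _, rfl⟩

lemma newton {σ : Type*} [Fintype σ] (α : σ → ℂ) (e : ℕ → ℂ)
    (he : ∀ k, e k = (-1)^k * MvPolynomial.aeval α (MvPolynomial.esymm σ ℂ k)) (k : ℕ) :
    (k : ℂ) * e k = ∑ n ∈ Finset.Icc 1 k, (-∑ i, α i ^ n) * e (k - n) := by
  have h := congrArg (MvPolynomial.aeval α) (MvPolynomial.mul_esymm_eq_sum σ ℂ k)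
  simp only [map_mul, map_sum, map_pow, map_neg, map_one, map_natCast, MvPolynomial.psum, MvPolynomial.aeval_X] at h
  rw [he, mul_left_comm, h, ← mul_assoc, ← pow_add, show k + (k+1) = 2 * k + 1 by ring, pow_succ, pow_mul]
  simp only [neg_one_sq, one_pow, one_mul]
  rw [Finset.mul_sum]
  refine Finset.sum_nbij' (fun a => a.2) (fun n => (k - n, n)) ?_ ?_ ?_ ?_ ?_
  · intro a ha
    simp at ha ⊢; omega
  · intro n hn
    simp at hn ⊢; omega
  · intro a ha
    simp at ha
    ext <;> simp; omega
  · intro n hn; rfl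
  · intro a ha
    simp at ha
    have : k - a.2 = a.1 := by omega
    rw [this, he]; ring

lemma exists_roots (c : ℕ → ℂ) (m : ℕ) (hm : 1 ≤ m) (h0 : c 0 = 1) (hb : ∀ d ≥ m, c d = 0) :
    ∃ α : Fin (m-1) → ℂ, ∀ k, c k = (-1)^k * MvPolynomial.aeval α (MvPolynomial.esymm (Fin (m-1)) ℂ k) := by
  obtain ⟨N, rfl⟩ : ∃ N, m = N + 1 := ⟨m - 1, by omega⟩
  rw [Nat.add_sub_cancel]
  let Q : Polynomial ℂ := ∑ d ∈ Finset.range (N+1), C (c d) * X ^ (N - d)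
  have hc : ∀ k ≤ N, Q.coeff k = c (N - k) := by
    intro k hk
    simp only [Q, finsetSum_coeff, coeff_C_mul, coeff_X_pow]
    rw [Finset.sum_eq_single (N - k)]
    · rw [if_pos (by omega), mul_one]
    · intro b hb hne
      rw [Finset.mem_range] at hb
      rw [if_neg (by omega), mul_zero]
    · intro h; exact absurd (Finset.mem_range.mpr (by omega)) h
  have hdeg : Q.natDegree ≤ N := by
    refine natDegree_sum_le_of_forall_le _ _ fun d _ => ?_
    exact (natDegree_C_mul_X_pow_le _ _).trans (Nat.sub_le _ _)
  have hlead : Q.coeff N = 1 := by rw [hc N le_rfl, Nat.sub_self, h0]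
  have hdeg' : Q.natDegree = N := le_antisymm hdeg (le_natDegree_of_ne_zero (by rw [hlead]; exact one_ne_zero))
  have hmon : Q.Monic := by rw [Monic, leadingCoeff, hdeg', hlead]
  have hcard : Q.roots.card = N := by rw [splits_iff_card_roots.mp (IsAlgClosed.splits Q), hdeg']
  have hprod : Q = (Q.roots.map fun a => X - C a).prod := by
    conv_lhs => rw [(IsAlgClosed.splits Q).eq_prod_roots, hmon.leadingCoeff, C_1, one_mul]
  have hlen : Q.roots.toList.length = N := by rw [Multiset.length_toList, hcard]
  let α : Fin N → ℂ := fun i => Q.roots.toList.get (Fin.cast hlen.symm i)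
  have hα : (Finset.univ : Finset (Fin N)).val.map α = Q.roots := by
    rw [Fin.univ_val_map]
    have : List.ofFn α = Q.roots.toList := by
      apply List.ext_get
      · rw [List.length_ofFn, hlen]
      · intro n h1 h2; simp [α]
    rw [this, Multiset.coe_toList]
  refine ⟨α, fun k => ?_⟩
  rw [MvPolynomial.aeval_esymm_eq_multiset_esymm, hα]
  by_cases hk : k ≤ N
  · have h1 := hc (N - k) (by omega)
    rw [hprod, Multiset.prod_X_sub_C_coeff _ (by omega), hcard, show N - (N - k) = k by omega] at h1
    exact h1.symm
  · rw [hb k (by omega), Multiset.esymm, Multiset.powersetCard_eq_empty _ (by omega)]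
    simp

theorem weil_abs (c S : ℕ → ℂ) (m : ℕ) (hm : 1 ≤ m) (h0 : c 0 = 1) (hb : ∀ d ≥ m, c d = 0)
    (hid : ∀ d : ℕ, (d : ℂ) * c d = ∑ n ∈ Finset.Icc 1 d, S n * c (d - n))
    (q : ℝ) (hq : 0 < q) (C : ℝ) (N0 : ℕ) (hS : ∀ n ≥ N0, ‖S (2*n)‖ ≤ C * q ^ n) :
    ‖S 1‖ ≤ (m - 1 : ℕ) * √q ∧ ∀ s, ‖c s‖ ≤ ((m-1).choose s) * √q ^ s := by
  obtain ⟨α, hα⟩ := exists_roots c m hm h0 hb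
  have hSp : ∀ n, 1 ≤ n → S n = -∑ i, α i ^ n := by
    intro n
    induction n using Nat.strong_induction_on with
    | _ n ih =>
      intro hn
      have h1 := hid n
      rw [newton α c hα n, ← sub_eq_zero, ← Finset.sum_sub_distrib] at h1
      rw [Finset.sum_eq_single n] at h1
      · rw [Nat.sub_self, h0, mul_one, mul_one, sub_eq_zero] at h1
        exact h1.symm
      · intro b hb hne
        rw [Finset.mem_Icc] at hb
        rw [ih b (by omega) hb.1, sub_self]
      · intro h; exact absurd (Finset.mem_Icc.mpr ⟨hn, le_rfl⟩) h
  have hr := root_bound q hq α C (N0 + 1) (fun n hn => by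
    have := hS n (by omega)
    rwa [hSp _ (by omega), norm_neg] at this)
  constructor
  · rw [hSp 1 le_rfl, norm_neg]
    refine (norm_sum_le _ _).trans ((Finset.sum_le_sum (g := fun _ => √q) fun i _ => by rw [pow_one]; exact hr i).trans ?_)
    simp
  · intro s
    rw [hα, norm_mul, norm_pow, norm_neg, norm_one, one_pow, one_mul, MvPolynomial.esymm]
    simp only [map_sum, map_prod, MvPolynomial.aeval_X]
    refine (norm_sum_le _ _).trans ((Finset.sum_le_sum (g := fun _ => √q ^ s) fun t ht => ?_).trans ?_)
    · rw [norm_prod]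
      refine (Finset.prod_le_prod (fun _ _ => norm_nonneg _) fun i _ => hr i).trans ?_
      rw [Finset.prod_const, (Finset.mem_powersetCard.mp ht).2]
    · rw [Finset.sum_const, nsmul_eq_mul, Finset.card_powersetCard, Finset.card_univ, Fintype.card_fin]

end St

namespace St
section
variable {F : Type*} [Field F] [Fintype F] {m : ℕ}

lemma SS_one {K : Type*} [Field K] [Algebra F K] [IsAlgClosed K] (χ : AddChar (GG F m) ℂ) :
    SS K χ 1 = ∑ x : F, χ (tau m (lin x)) := by
  unfold SS
  symm
  have key : ∀ a : F, Fr F K 1 (algebraMap F K a) = algebraMap F K a := fun a => by simp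
  refine Finset.sum_bij (fun a _ => algebraMap F K a) ?_ ?_ ?_ ?_
  · intro a _
    rw [mem_Fx one_ne_zero]; exact key a
  · intro a _ b _ h; exact (algebraMap F K).injective h
  · intro y hy
    rw [mem_Fx one_ne_zero] at hy
    obtain ⟨a, ha⟩ := mem_range_of_Fr y hy
    exact ⟨a, Finset.mem_univ _, ha⟩
  · intro a _
    have : PF F 1 (algebraMap F K a) = X - C a := by
      apply Polynomial.map_injective _ (algebraMap F K).injective
      rw [(PF_spec (key a)).1, PK]
      simp
    rw [this, th, rev_lin]

theorem weil (hm : 1 ≤ m) (χ : AddChar (GG F m) ℂ) (hχ : χ ≠ 0) :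
    ‖∑ x : F, χ (tau m (lin x))‖ ≤ (m - 1 : ℕ) * √(Fintype.card F : ℝ) ∧
    ∀ s, ‖cc χ s‖ ≤ ((m-1).choose s) * √(Fintype.card F : ℝ) ^ s := by
  obtain ⟨C, N0, h⟩ := SS_bound (F := F) (K := AlgebraicClosure F) hm
  rw [← SS_one (K := AlgebraicClosure F)]
  exact weil_abs (cc χ) (SS (AlgebraicClosure F) χ) m hm (cc_zero χ) (cc_big χ hχ)
    (main_id χ) _ (by exact_mod_cast Fintype.card_pos) C N0 (h χ hχ)
end

section
variable (A : ℝ)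
noncomputable def RR (r : ℕ) : ℝ := (∏ i ∈ Finset.range r, (A + i)) / r.factorial

lemma RR_succ (r : ℕ) : ((r+1 : ℕ) : ℝ) * RR A (r+1) = (A + r) * RR A r := by
  unfold RR
  rw [Finset.prod_range_succ, Nat.factorial_succ]
  have : (r.factorial : ℝ) ≠ 0 := by exact_mod_cast r.factorial_ne_zero
  push_cast
  field_simp

lemma RR_sum (r : ℕ) : (r : ℝ) * RR A r = A * ∑ k ∈ Finset.range r, RR A k := by
  induction r with
  | zero => simp
  | succ r ih =>
    rw [RR_succ, Finset.sum_range_succ, mul_add, ← ih]; ring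

lemma RR_nonneg (hA : 1 ≤ A) (r : ℕ) : 0 ≤ RR A r := by
  unfold RR; positivity

lemma RR_mono (hA : 1 ≤ A) : Monotone (RR A) := by
  refine monotone_nat_of_le_succ fun r => ?_
  have h1 := RR_succ A r
  have h2 := RR_nonneg A hA r
  push_cast at h1
  have h3 : ((r:ℝ) + 1) * RR A r ≤ ((r:ℝ)+1) * RR A (r+1) := by
    rw [h1]; exact mul_le_mul_of_nonneg_right (by linarith) h2
  exact le_of_mul_le_mul_left h3 (by positivity)
end

lemma block (R : ℕ → ℝ) (hR : Monotone R) (hR0 : ∀ n, 0 ≤ R n) (p : ℕ) (hp : 1 ≤ p) (r : ℕ) :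
    (p : ℝ) * ∑ k ∈ Finset.range r, (if p ∣ r - k then R k else 0) ≤ ∑ k ∈ Finset.range r, R k := by
  induction r using Nat.strong_induction_on with
  | _ r ih =>
    by_cases hr : r < p
    · rw [Finset.sum_eq_zero, mul_zero]
      · exact Finset.sum_nonneg fun k _ => hR0 k
      · intro k hk
        rw [Finset.mem_range] at hk
        rw [if_neg]
        intro h
        have := Nat.le_of_dvd (by omega) h
        omega
    · obtain ⟨n, rfl⟩ : ∃ n, r = n + p := ⟨r - p, by omega⟩
      have h1 := ih n (by omega)
      rw [Finset.sum_range_add, Finset.sum_range_add]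
      have e1 : ∑ k ∈ Finset.range n, (if p ∣ n + p - k then R k else 0) =
          ∑ k ∈ Finset.range n, (if p ∣ n - k then R k else 0) := by
        refine Finset.sum_congr rfl fun k hk => ?_
        rw [Finset.mem_range] at hk
        have : n + p - k = n - k + p := by omega
        simp only [this, Nat.dvd_add_self_right]
      have e2 : ∑ k ∈ Finset.range p, (if p ∣ n + p - (n + k) then R (n + k) else 0) = R n := by
        rw [Finset.sum_eq_single 0]
        · simp
        · intro b hb hne
          rw [Finset.mem_range] at hb
          rw [if_neg]
          intro h
          have := Nat.le_of_dvd (by omega) h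
          omega
        · intro h; simp at h; omega
      have e3 : (p : ℝ) * R n ≤ ∑ k ∈ Finset.range p, R (n + k) := by
        have := Finset.card_nsmul_le_sum (Finset.range p) (fun k => R (n+k)) (R n) (fun k _ => hR (by omega))
        simpa using this
      rw [e1, e2, mul_add]
      linarith

theorem sieve_abs {σ : Type*} [Fintype σ] (z : σ → ℂ) (p : ℕ) (hp : 1 ≤ p) (a Q A : ℝ) (haQ : a ≤ Q)
    (ha : 0 ≤ a) (hA1 : 1 ≤ A) (hA : a + (Q - a) / p ≤ A)
    (h1 : ∀ i, ‖∑ x, z x ^ i‖ ≤ Q) (h2 : ∀ i, ¬ p ∣ i → ‖∑ x, z x ^ i‖ ≤ a) (r : ℕ) :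
    ‖MvPolynomial.aeval z (MvPolynomial.esymm σ ℂ r)‖ ≤ RR A r := by
  let e : ℕ → ℂ := fun k => (-1)^k * MvPolynomial.aeval z (MvPolynomial.esymm σ ℂ k)
  have hn : ∀ k, ‖e k‖ = ‖MvPolynomial.aeval z (MvPolynomial.esymm σ ℂ k)‖ := by
    intro k; simp [e]
  have hN := newton z e (fun _ => rfl)
  rw [← hn]
  induction r using Nat.strong_induction_on with
  | _ r ih =>
    rcases Nat.eq_zero_or_pos r with rfl | hr
    · simp [e, RR]
    have hp0 : (0:ℝ) < p := by exact_mod_cast hp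
    have hR := RR_mono A hA1
    have hR0 := RR_nonneg A hA1
    have hb := block (RR A) hR hR0 p hp r
    have hle : (r:ℝ) * ‖e r‖ ≤ ∑ k ∈ Finset.range r, (a * RR A k + (Q - a) * (if p ∣ r - k then RR A k else 0)) := by
      have : (r:ℝ) * ‖e r‖ = ‖(r:ℂ) * e r‖ := by rw [norm_mul (r:ℂ) (e r), Complex.norm_natCast]
      rw [this, hN r]
      refine (norm_sum_le _ _).trans ?_
      have hre : ∑ n ∈ Finset.Icc 1 r, ‖(-∑ i, z i ^ n) * e (r - n)‖ =
          ∑ k ∈ Finset.range r, ‖(-∑ i, z i ^ (r - k)) * e k‖ := by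
        refine Finset.sum_nbij' (fun n => r - n) (fun k => r - k) ?_ ?_ ?_ ?_ ?_
        · intro n hn; simp at hn ⊢; omega
        · intro n hn; simp at hn ⊢; omega
        · intro n hn; simp at hn ⊢; omega
        · intro n hn; simp at hn ⊢; omega
        · intro n hn
          simp only [Finset.mem_Icc] at hn
          rw [show r - (r - n) = n by omega]
      rw [hre]
      refine Finset.sum_le_sum fun k hk => ?_
      rw [Finset.mem_range] at hk
      rw [norm_mul, norm_neg]
      have hk1 := ih k hk
      have hk0 := hR0 k
      split_ifs with hd
      · calc _ ≤ Q * RR A k := mul_le_mul (h1 _) hk1 (norm_nonneg _) (by linarith)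
          _ = _ := by ring
      · calc _ ≤ a * RR A k := mul_le_mul (h2 _ hd) hk1 (norm_nonneg _) ha
          _ = _ := by ring
    rw [Finset.sum_add_distrib, ← Finset.mul_sum, ← Finset.mul_sum] at hle
    set U := ∑ k ∈ Finset.range r, RR A k
    set T := ∑ k ∈ Finset.range r, (if p ∣ r - k then RR A k else 0)
    have hU : 0 ≤ U := Finset.sum_nonneg fun k _ => hR0 k
    have hT : T ≤ U / p := by rw [le_div_iff₀ hp0]; linarith
    have h3 : a * U + (Q - a) * T ≤ A * U := by
      calc a * U + (Q - a) * T ≤ a * U + (Q - a) * (U / p) := by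
            gcongr
        _ = (a + (Q - a) / p) * U := by ring
        _ ≤ _ := mul_le_mul_of_nonneg_right hA hU
    have h4 := RR_sum A r
    have : (r:ℝ) * ‖e r‖ ≤ r * RR A r := by rw [h4]; linarith
    exact le_of_mul_le_mul_left this (by exact_mod_cast hr)

end St

namespace St

open Classical in
lemma card_inj (F : Type*) [Fintype F] (r : ℕ) (t : Finset F) :
    (Finset.univ.filter fun x : Fin r → F => Function.Injective x ∧ ∀ i, x i ∈ t).card =
      t.card.descFactorial r := by
  have : (Finset.univ.filter fun x : Fin r → F => Function.Injective x ∧ ∀ i, x i ∈ t) =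
      (Finset.univ : Finset (Fin r ↪ {a // a ∈ t})).image (fun e i => (e i : F)) := by
    ext x
    simp only [Finset.mem_filter, Finset.mem_univ, true_and, Finset.mem_image]
    constructor
    · rintro ⟨h1, h2⟩
      exact ⟨⟨fun i => ⟨x i, h2 i⟩, fun i j h => h1 (congrArg Subtype.val h)⟩, rfl⟩
    · rintro ⟨e, rfl⟩
      exact ⟨fun i j h => e.injective (Subtype.ext h), fun i => (e i).2⟩
  rw [this, Finset.card_image_of_injective, Finset.card_univ, Fintype.card_embedding_eq]
  · simp
  · intro e e' h
    ext i
    exact congrFun h i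

open Classical in
lemma sum_inj {F : Type*} [Fintype F] (z : F → ℂ) (r : ℕ) :
    ∑ x ∈ Finset.univ.filter (fun x : Fin r → F => Function.Injective x), ∏ i, z (x i) =
      r.factorial * MvPolynomial.aeval z (MvPolynomial.esymm F ℂ r) := by
  rw [MvPolynomial.esymm]
  simp only [map_sum, map_prod, MvPolynomial.aeval_X]
  rw [← Finset.sum_fiberwise_of_maps_to (t := Finset.powersetCard r Finset.univ)
    (g := fun x : Fin r → F => Finset.univ.image x), Finset.mul_sum]
  · refine Finset.sum_congr rfl fun t ht => ?_
    have htc := (Finset.mem_powersetCard.mp ht).2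
    have e : (Finset.univ.filter (fun x : Fin r → F => Function.Injective x)).filter
        (fun x => Finset.univ.image x = t) =
        Finset.univ.filter fun x : Fin r → F => Function.Injective x ∧ ∀ i, x i ∈ t := by
      ext x
      simp only [Finset.mem_filter, Finset.mem_univ, true_and]
      refine and_congr_right fun hx => ⟨?_, fun h => ?_⟩
      · rintro rfl i; exact Finset.mem_image_of_mem _ (Finset.mem_univ _)
      · refine Finset.eq_of_subset_of_card_le ?_ ?_
        · intro y hy
          obtain ⟨i, -, rfl⟩ := Finset.mem_image.mp hy
          exact h i
        · rw [Finset.card_image_of_injective _ hx, htc]; simp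
    rw [Finset.sum_congr rfl (g := fun _ => ∏ a ∈ t, z a), Finset.sum_const, nsmul_eq_mul, e, card_inj, htc,
      Nat.descFactorial_self]
    intro x hx
    simp only [Finset.mem_filter, Finset.mem_univ, true_and] at hx
    rw [← hx.2, Finset.prod_image fun i _ j _ h => hx.1 h]
  · intro x hx
    simp only [Finset.mem_filter, Finset.mem_univ, true_and] at hx
    rw [Finset.mem_powersetCard]
    refine ⟨Finset.subset_univ _, ?_⟩
    rw [Finset.card_image_of_injective _ hx]; simp

section
variable {F : Type*} [Field F] [Fintype F] {m : ℕ}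

open Classical in
noncomputable def AA (χ : AddChar (GG F m) ℂ) (r : ℕ) : ℂ :=
  ∑ x ∈ Finset.univ.filter (fun x : Fin r → F => Function.Injective x), ∏ i, χ (tau m (lin (x i)))

lemma AA_zero (r : ℕ) : AA (0 : AddChar (GG F m) ℂ) r = ((Fintype.card F).descFactorial r : ℕ) := by
  classical
  unfold AA
  have := card_inj F r Finset.univ
  simp only [Finset.mem_univ, implies_true, and_true, Finset.card_univ] at this
  simp [this]

theorem AA_bound (hm : 1 ≤ m) (p : ℕ) [hp : Fact p.Prime] [CharP F p] (χ : AddChar (GG F m) ℂ) (hχ : χ ≠ 0) (r : ℕ) :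
    ‖AA χ r‖ ≤ ∏ i ∈ Finset.range r,
      ((Fintype.card F : ℝ) / p + m * √(Fintype.card F : ℝ) + i) := by
  classical
  set q := Fintype.card F with hq
  set A := (q : ℝ) / p + m * √(q : ℝ) with hA
  have hp0 : (0:ℝ) < p := by exact_mod_cast hp.out.pos
  obtain ⟨n, -, hqn⟩ := FiniteField.card F p
  rw [← hq] at hqn
  have hq1 : (p:ℝ) ≤ q := by
    rw [hqn]; push_cast
    exact le_self_pow₀ (by exact_mod_cast hp.out.one_lt.le) n.ne_zero
  set b := ((m - 1 : ℕ) : ℝ) * √(q:ℝ) with hb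
  have hb0 : 0 ≤ b := by positivity
  have hbm : b ≤ m * √(q:ℝ) := by
    rw [hb]; gcongr; omega
  unfold AA
  rw [sum_inj (fun x => χ (tau m (lin x)))]
  have hQ : ∀ i : ℕ, ‖∑ x : F, χ (tau m (lin x)) ^ i‖ ≤ q := by
    intro i
    refine (norm_sum_le _ _).trans ?_
    simp [hq]
  have key := sieve_abs (fun x : F => χ (tau m (lin x))) p hp.out.one_lt.le (min (q:ℝ) b) q A (min_le_left _ _)
    (le_min (by positivity) hb0) ?_ ?_ hQ ?_ r
  · rw [norm_mul, Complex.norm_natCast]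
    refine (mul_le_mul_of_nonneg_left key (by positivity)).trans (le_of_eq ?_)
    unfold RR
    have : (r.factorial : ℝ) ≠ 0 := by exact_mod_cast r.factorial_ne_zero
    field_simp
  · have : 1 ≤ (q:ℝ)/p := by rw [le_div_iff₀ hp0]; linarith
    have : 0 ≤ m * √(q:ℝ) := by positivity
    linarith
  · set a := min (q:ℝ) b with ha
    have h1 : a ≤ b := min_le_right _ _
    have h2 : 0 ≤ a := le_min (by positivity) hb0
    have h3 : (q - a) / p ≤ (q:ℝ)/p := by gcongr; linarith
    linarith
  · intro i hi
    refine le_min (hQ i) ?_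
    have hne : χ ^ i ≠ 0 := by
      intro h
      apply hχ
      rw [AddChar.eq_zero_iff]
      intro g
      have h1 : χ g ^ i = 1 := by
        have := AddChar.eq_zero_iff.mp h g
        rwa [AddChar.pow_apply] at this
      have h2 : χ g ^ (q ^ m) = 1 := by
        rw [← card_GG (F := F) (m := m), ← AddChar.map_nsmul_eq_pow, card_nsmul_eq_zero, AddChar.map_zero_eq_one]
      have hc : Nat.gcd i (q^m) = 1 := by
        rw [hqn, ← pow_mul]
        exact Nat.Coprime.pow_right _ ((Nat.Prime.coprime_iff_not_dvd hp.out).mpr hi).symm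
      have := pow_gcd_eq_one.mpr ⟨h1, h2⟩
      rwa [hc, pow_one] at this
    have := (weil hm (χ ^ i) hne).1
    simpa [AddChar.pow_apply] using this
end
end St

namespace St
section
variable {F : Type*} [Field F] [Fintype F] {m : ℕ}

lemma prod_lin {ι : Type*} (s : Finset ι) (x : ι → F) :
    PowerSeries.coeff 0 (∏ i ∈ s, lin (x i)) = 1 ∧
    tau m (∏ i ∈ s, lin (x i)) = ∑ i ∈ s, tau m (lin (x i)) := by
  classical
  induction s using Finset.induction with
  | empty => simp [tau_one]
  | insert a s ha ih =>
    rw [Finset.prod_insert ha, Finset.sum_insert ha]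
    exact ⟨coeff_zero_mul (coeff_zero_lin _) ih.1, by rw [tau_mul (coeff_zero_lin _) ih.1, ih.2]⟩

lemma count_eq (r s : ℕ) (f : Polynomial F) (hf : f.coeff 0 = 1) :
    Nat.card {xh : (Fin r → F) × Polynomial F //
          Function.Injective xh.1 ∧
          xh.2.degree ≤ (s : WithBot ℕ) ∧ xh.2.coeff 0 = 1 ∧
          ∀ i ≤ m, ((∏ j : Fin r, (1 - Polynomial.C (xh.1 j) * X)) * xh.2).coeff i
            = f.coeff i} =
    Nat.card {y : (Fin r → F) × GG F s // Function.Injective y.1 ∧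
      ∑ i, tau m (lin (y.1 i)) + tau m (sig y.2) - tau m (f : PowerSeries F) = 0} := by
  have hcond : ∀ (x : Fin r → F) (h : Polynomial F), h.coeff 0 = 1 →
      ((∀ i ≤ m, ((∏ j : Fin r, (1 - Polynomial.C (x j) * X)) * h).coeff i = f.coeff i) ↔
        ∑ i, tau m (lin (x i)) + tau m (h : PowerSeries F) - tau m (f : PowerSeries F) = 0) := by
    intro x h hh
    have hh' : PowerSeries.coeff 0 (h : PowerSeries F) = 1 := by rw [coeff_coe, hh]
    rw [sub_eq_zero, ← (prod_lin (m := m) Finset.univ x).2, ← tau_mul (prod_lin (m := m) _ _).1 hh',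
      tau_eq_iff (coeff_zero_mul (prod_lin (m := m) _ _).1 hh') (by rw [coeff_coe, hf])]
    refine forall_congr' fun i => imp_congr_right fun _ => ?_
    rw [coeff_coe, ← coeff_coe]
    have : (((∏ j : Fin r, (1 - Polynomial.C (x j) * X)) * h : Polynomial F) : PowerSeries F) =
        (∏ j, lin (x j)) * (h : PowerSeries F) := by
      rw [Polynomial.coe_mul]
      congr 1
      have := map_prod (Polynomial.coeToPowerSeries.ringHom (R := F)) (fun j => (1 - Polynomial.C (x j) * X)) Finset.univ
      simp only [Polynomial.coeToPowerSeries.ringHom_apply] at this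
      rw [this]
      refine Finset.prod_congr rfl fun j _ => ?_
      simp [lin]
    rw [this]
  have hsig : ∀ h : Polynomial F, h.degree ≤ (s : WithBot ℕ) → h.coeff 0 = 1 →
      sig (tau s (h : PowerSeries F)) = (h : PowerSeries F) := by
    intro h hd h0
    ext i
    by_cases hi : i ≤ s
    · exact sig_tau (by rw [coeff_coe, h0]) i hi
    · rw [coeff_coe, coeff_eq_zero_of_degree_lt (hd.trans_lt (by exact_mod_cast (by omega)))]
      simp only [sig, PowerSeries.coeff_mk]
      rw [if_neg (by omega), dif_neg (by omega)]
  refine Nat.card_eq_of_bijective (fun z => ⟨(z.1.1, tau s (z.1.2 : PowerSeries F)), z.2.1, ?_⟩) ⟨?_, ?_⟩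
  · rw [hsig _ z.2.2.1 z.2.2.2.1]
    exact (hcond _ _ z.2.2.2.1).mp z.2.2.2.2
  · rintro ⟨⟨x, h⟩, a1, a2, a3, a4⟩ ⟨⟨x', h'⟩, b1, b2, b3, b4⟩ e
    simp only [Subtype.mk.injEq, Prod.mk.injEq] at e ⊢
    refine ⟨e.1, ?_⟩
    apply Polynomial.coe_injective
    rw [← hsig h a2 a3, ← hsig h' b2 b3, e.2]
  · rintro ⟨⟨x, a⟩, h1, h2⟩
    let h : Polynomial F := PowerSeries.trunc (s+1) (sig a)
    have hh : (h : PowerSeries F) = sig a := by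
      ext i
      rw [coeff_coe, PowerSeries.coeff_trunc]
      split_ifs with hi
      · rfl
      · simp only [sig, PowerSeries.coeff_mk]
        rw [if_neg (by omega), dif_neg (by omega)]
    have h0 : h.coeff 0 = 1 := by rw [← coeff_coe, hh, sig_zero]
    have hd : h.degree ≤ (s : WithBot ℕ) := by
      rw [degree_le_iff_coeff_zero]
      intro n hn
      have hn : s < n := by exact_mod_cast hn
      rw [PowerSeries.coeff_trunc, if_neg (by omega)]
    refine ⟨⟨(x, h), h1, hd, h0, (hcond x h h0).mpr (by rw [hh]; exact h2)⟩, ?_⟩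
    simp only [Subtype.mk.injEq, Prod.mk.injEq, true_and]
    rw [hh, tau_sig]

lemma count_char (r s : ℕ) (g : GG F m) :
    ((Fintype.card F : ℂ) ^ m) * (Nat.card {y : (Fin r → F) × GG F s // Function.Injective y.1 ∧
      ∑ i, tau m (lin (y.1 i)) + tau m (sig y.2) - g = 0} : ℂ) =
    ∑ χ : AddChar (GG F m) ℂ, χ (-g) * (AA χ r * cc χ s) := by
  classical
  rw [Nat.card_eq_fintype_card, Fintype.card_subtype]
  have h1 : ∀ χ : AddChar (GG F m) ℂ, χ (-g) * (AA χ r * cc χ s) =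
      ∑ y : (Fin r → F) × GG F s, if Function.Injective y.1 then
        χ (∑ i, tau m (lin (y.1 i)) + tau m (sig y.2) - g) else 0 := by
    intro χ
    unfold AA cc
    rw [Finset.sum_filter, Finset.sum_mul_sum, Finset.mul_sum, Fintype.sum_prod_type]
    refine Finset.sum_congr rfl fun x _ => ?_
    rw [Finset.mul_sum]
    refine Finset.sum_congr rfl fun a _ => ?_
    simp only
    split_ifs
    · have hs : ∀ t : Finset (Fin r), χ (∑ i ∈ t, tau m (lin (x i))) = ∏ i ∈ t, χ (tau m (lin (x i))) := by
        intro t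
        induction t using Finset.induction with
        | empty => simp
        | insert a t ha ih => rw [Finset.sum_insert ha, Finset.prod_insert ha, AddChar.map_add_eq_mul, ih]
      rw [sub_eq_add_neg, AddChar.map_add_eq_mul, AddChar.map_add_eq_mul, hs]; ring
    · simp
  rw [Finset.sum_congr rfl fun χ _ => h1 χ, Finset.sum_comm, Finset.card_filter]
  push_cast
  rw [Finset.mul_sum]
  refine Finset.sum_congr rfl fun y _ => ?_
  by_cases hy : Function.Injective y.1
  · simp only [hy, true_and, if_true]
    rw [AddChar.sum_apply_eq_ite, card_GG]
    split_ifs <;> simp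
  · simp [hy]

end

theorem main {F : Type*} [Field F] [Fintype F] 
    (q p : ℕ) (hcard : Fintype.card F = q) [hp : Fact p.Prime] [CharP F p]
    (k m r : ℕ) (hkm : k + m ≤ q - 1)
    (hr1 : k + 1 ≤ r) (hr2 : r ≤ k + m)
    (f : Polynomial F) (hf0 : f.coeff 0 = 1) :
    |(Nat.card {xh : (Fin r → F) × Polynomial F //
          Function.Injective xh.1 ∧
          xh.2.degree ≤ ((k + m - r : ℕ) : WithBot ℕ) ∧ xh.2.coeff 0 = 1 ∧
          ∀ i ≤ m, ((∏ j : Fin r, (1 - Polynomial.C (xh.1 j) * X)) * xh.2).coeff i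
            = f.coeff i} : ℝ)
        - fallFac (q : ℝ) r * (q : ℝ) ^ ((k : ℤ) - (r : ℤ))|
      ≤ fallFac ((q : ℝ) / (p : ℝ) + (m : ℝ) * Real.sqrt q + (r : ℝ) - 1) r *
          ((m - 1).choose (k + m - r) : ℝ) * Real.sqrt q ^ (k + m - r) := by
  classical
  have hm : 1 ≤ m := by omega
  have hq0 : (0:ℝ) < q := by rw [← hcard]; exact_mod_cast Fintype.card_pos
  set s := k + m - r with hs
  rw [count_eq r s f hf0]
  have hc := count_char r s (tau m (f : PowerSeries F))
  set N := Nat.card {y : (Fin r → F) × GG F s // Function.Injective y.1 ∧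
      ∑ i, tau m (lin (y.1 i)) + tau m (sig y.2) - tau m (f : PowerSeries F) = 0} with hN
  have e1 : fallFac ((q : ℝ) / (p : ℝ) + (m : ℝ) * Real.sqrt q + (r : ℝ) - 1) r =
      ∏ i ∈ Finset.range r, ((q : ℝ) / p + m * √(q : ℝ) + i) := by
    unfold fallFac
    rw [← Finset.prod_range_reflect]
    refine Finset.prod_congr rfl fun i hi => ?_
    rw [Finset.mem_range] at hi
    rw [Nat.sub_sub, Nat.cast_sub (by omega)]
    push_cast; ring
  have e2 : fallFac (q : ℝ) r = (q.descFactorial r : ℝ) := by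
    unfold fallFac
    rw [Nat.descFactorial_eq_prod_range]
    push_cast
    refine Finset.prod_congr rfl fun i hi => ?_
    rw [Finset.mem_range] at hi
    rw [Nat.cast_sub (by omega)]
  set B := fallFac ((q : ℝ) / (p : ℝ) + (m : ℝ) * Real.sqrt q + (r : ℝ) - 1) r *
          ((m - 1).choose s : ℝ) * Real.sqrt q ^ s with hB
  have hB0 : 0 ≤ B := by
    rw [hB, e1]; positivity
  have hbd : ∀ χ : AddChar (GG F m) ℂ, χ ≠ 0 →
      ‖χ (-tau m (f : PowerSeries F)) * (AA χ r * cc χ s)‖ ≤ B := by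
    intro χ hχ
    have h1 := AA_bound hm p χ hχ r
    have h2 := (weil hm χ hχ).2 s
    rw [hcard] at h1 h2
    rw [norm_mul, norm_chi, one_mul, norm_mul, hB, e1, mul_assoc]
    exact mul_le_mul h1 h2 (norm_nonneg _) (by positivity)
  have h0 : (0 : AddChar (GG F m) ℂ) (-tau m (f : PowerSeries F)) *
      (AA (0 : AddChar (GG F m) ℂ) r * cc (0 : AddChar (GG F m) ℂ) s) = (q.descFactorial r : ℂ) * (q:ℂ)^s := by
    rw [AA_zero, hcard, cc, AddChar.zero_apply, one_mul]
    simp [card_GG, hcard]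
  rw [← Finset.add_sum_erase _ _ (Finset.mem_univ (0 : AddChar (GG F m) ℂ)), h0, hcard] at hc
  have hmain : ‖(q:ℂ)^m * N - (q.descFactorial r : ℂ) * (q:ℂ)^s‖ ≤ (q:ℝ)^m * B := by
    rw [hc, add_sub_cancel_left]
    refine (norm_sum_le _ _).trans ((Finset.sum_le_sum fun χ hχ => hbd χ (Finset.ne_of_mem_erase hχ)).trans ?_)
    rw [Finset.sum_const, nsmul_eq_mul]
    refine mul_le_mul_of_nonneg_right ?_ hB0
    have : (Finset.univ.erase (0 : AddChar (GG F m) ℂ)).card ≤ q ^ m := by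
      refine (Finset.card_erase_le).trans ?_
      rw [Finset.card_univ, AddChar.card_eq, card_GG, hcard]
    exact_mod_cast this
  have e3 : (q:ℂ)^m * N - (q.descFactorial r : ℂ) * (q:ℂ)^s =
      (((q:ℝ)^m * ((N:ℝ) - fallFac q r * (q:ℝ)^((k:ℤ) - r)) : ℝ) : ℂ) := by
    have : (q:ℝ)^m * (q:ℝ)^((k:ℤ) - r) = (q:ℝ)^s := by
      rw [← zpow_natCast, ← zpow_natCast, ← zpow_add₀ hq0.ne']
      congr 1
      omega
    rw [e2]
    have h : (q:ℝ)^m * ((N:ℝ) - (q.descFactorial r : ℝ) * (q:ℝ)^((k:ℤ) - r)) =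
        (q:ℝ)^m * N - (q.descFactorial r : ℝ) * (q:ℝ)^s := by rw [← this]; ring
    rw [h]; push_cast; rfl
  rw [e3, Complex.norm_real, Real.norm_eq_abs, abs_mul, abs_of_pos (by positivity : (0:ℝ) < (q:ℝ)^m)] at hmain
  exact le_of_mul_le_mul_left hmain (by positivity)
end St

/-- For `f` with `f(0) = 1`, `deg f ≤ d = k+m ≤ q-1` and `k+1 ≤ r ≤ d`,
the number `N_2` of pairs `((x_1,…,x_r), h)` with the `x_i ∈ F_q` pairwise distinct,
`deg h ≤ d-r`, `h(0) = 1`, and `(1-x_1x)⋯(1-x_rx)h(x) ≡ f(x) (mod x^(m+1))` satisfies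
`|N_2 - (q)_r q^(k-r)| ≤ (q/p + m√q + r - 1)_r C(m-1, d-r) q^((d-r)/2)`. -/
theorem stmt_13 {F : Type*} [Field F] [Fintype F] [DecidableEq F]
    (q p : ℕ) (hcard : Fintype.card F = q) [hp : Fact p.Prime] [CharP F p]
    (k m r : ℕ) (hk : 1 ≤ k) (hkm : k + m ≤ q - 1)
    (hr1 : k + 1 ≤ r) (hr2 : r ≤ k + m)
    (f : Polynomial F) (hf0 : f.coeff 0 = 1) (hfdeg : f.natDegree ≤ k + m) :
    |(Nat.card {xh : (Fin r → F) × Polynomial F //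
          Function.Injective xh.1 ∧
          xh.2.degree ≤ ((k + m - r : ℕ) : WithBot ℕ) ∧ xh.2.coeff 0 = 1 ∧
          ∀ i ≤ m, ((∏ j : Fin r, (1 - Polynomial.C (xh.1 j) * X)) * xh.2).coeff i
            = f.coeff i} : ℝ)
        - fallFac (q : ℝ) r * (q : ℝ) ^ ((k : ℤ) - (r : ℤ))|
      ≤ fallFac ((q : ℝ) / (p : ℝ) + (m : ℝ) * Real.sqrt q + (r : ℝ) - 1) r *
          ((m - 1).choose (k + m - r) : ℝ) * Real.sqrt q ^ (k + m - r) := by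
  exact St.main q p hcard k m r hkm hr1 hr2 f hf0
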